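/- arXiv:2312.12711 — 2 statements merged into one kernel-verified Lean document; each statement's English description precedes it below -/
import Mathlib

section
/- For every ε > 0 there exists δ₀ > 0 such that for every 0 < δ ≤ δ₀ the following holds. Let D ⊂ ℝ² be a bounded open simply connected set and Ω ∈ ℝ, and assume the relative stream function Ψ(x) = (1/(2π)) ∫_D log|x − y| dy − Ω|x|²/2 takes a constant value on ∂D (i.e. D is a V-state with angular velocity Ω and rotation center the origin). If |Ω − 1/4| ≤ δ and |𝔻 Δ D| ≤ δ, then the boundary of D is a graph over its polar angle: there exists a 2π-periodic continuously differentiable function R : ℝ → (0,∞) such that ∂D = { R(θ)·(cos θ, sin θ) : θ ∈ ℝ }, and moreover sup_θ |R(θ) − 1| ≤ ε, sup_θ |R'(θ)| ≤ ε, and |R'(θ₁) − R'(θ₂)| ≤ ε·|θ₁ − θ₂|^{1/2} for all θ₁, θ₂ (i.e. ‖R − 1‖_{C^{1,1/2}} ≤ ε). -/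
open MeasureTheory Set

/-- The relative stream function of a patch `D` rotating with angular velocity `Ω`
about the origin: `Ψ(x) = (1/(2π)) ∫_D log|x − y| dy − Ω|x|²/2`. -/
noncomputable def relStream (D : Set ℂ) (Ω : ℝ) (x : ℂ) : ℝ :=
  (1 / (2 * Real.pi)) * (∫ y in D, Real.log ‖x - y‖) - Ω * ‖x‖ ^ 2 / 2

/-- `D` is a V-state with angular velocity `Ω` and rotation center the origin:
the relative stream function is constant on the topological boundary of `D`. -/
def IsVState (D : Set ℂ) (Ω : ℝ) : Prop :=
  ∃ c : ℝ, ∀ x ∈ frontier D, relStream D Ω x = c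

/-- The kernel `‖y‖ ^ (-3/2)`, which dominates all singular integrands below. -/
noncomputable def singKernel (y : ℂ) : ℝ := (√‖y‖ ^ 3)⁻¹

lemma singKernel_nonneg (y : ℂ) : 0 ≤ singKernel y := by
  unfold singKernel; positivity

lemma measurable_singKernel : Measurable singKernel := by
  unfold singKernel; fun_prop

lemma integrableOn_singKernel_ball : IntegrableOn singKernel (Metric.ball 0 1) := by
  have h : IntegrableOn (fun x : ℂ => (fun r : ℝ => (√r ^ 3)⁻¹) ‖x‖) (Metric.ball 0 1) := by
    refine (integrableOn_fun_norm_addHaar volume (f := fun r : ℝ => (√r ^ 3)⁻¹)).2 ?_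
    simp only [Complex.finrank_real_complex, Nat.reduceSub, pow_one, smul_eq_mul]
    have h2 : IntegrableOn (fun r : ℝ => r ^ (-(1 / 2) : ℝ)) (Ioo 0 1) := by
      rw [intervalIntegral.integrableOn_Ioo_rpow_iff one_pos]; norm_num
    refine h2.congr_fun (fun r hr => ?_) measurableSet_Ioo
    have hr0 : 0 < r := hr.1
    have hs : 0 < √r := Real.sqrt_pos.2 hr0
    have h3 : √r * √r = r := Real.mul_self_sqrt hr0.le
    change r ^ (-(1 / 2) : ℝ) = r * (√r ^ 3)⁻¹
    rw [Real.rpow_neg hr0.le, ← Real.sqrt_eq_rpow]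
    field_simp
    nlinarith
  exact h

lemma integrable_indicator_singKernel_sub (x : ℂ) :
    Integrable fun y => (Metric.ball (0 : ℂ) 1).indicator singKernel (x - y) :=
  (Measure.measurePreserving_sub_left volume x).integrable_comp_of_integrable
    ((integrable_indicator_iff measurableSet_ball).2 integrableOn_singKernel_ball)

lemma singKernel_le_indicator_add_one (y : ℂ) :
    singKernel y ≤ (Metric.ball (0 : ℂ) 1).indicator singKernel y + 1 := by
  by_cases hy : y ∈ Metric.ball (0 : ℂ) 1
  · simp [hy]
  · have h1 : 1 ≤ √‖y‖ := by
      rw [Real.one_le_sqrt]; simpa using hy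
    rw [indicator_of_notMem hy, singKernel, zero_add]
    exact inv_le_one_of_one_le₀ (one_le_pow₀ h1)

lemma integrableOn_singKernel_sub {E : Set ℂ} (hE : volume E ≠ ⊤) (x : ℂ) :
    IntegrableOn (fun y => singKernel (x - y)) E := by
  refine Integrable.mono'
    (g := fun y => (Metric.ball (0 : ℂ) 1).indicator singKernel (x - y) + 1)
    ((integrable_indicator_singKernel_sub x).integrableOn.add
    (integrableOn_const hE)) (measurable_singKernel.comp
      (measurable_const.sub measurable_id)).aestronglyMeasurable ?_
  refine Filter.Eventually.of_forall fun y => ?_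
  rw [Real.norm_of_nonneg (singKernel_nonneg _)]
  exact singKernel_le_indicator_add_one _

lemma exists_setIntegral_singKernel_le {κ : ℝ} (hκ : 0 < κ) :
    ∃ δ : ℝ, 0 < δ ∧ ∀ E : Set ℂ, MeasurableSet E → volume E < ENNReal.ofReal δ →
      ∀ x : ℂ, ∫ y in E, singKernel (x - y) ≤ κ := by
  set K : ℂ → ℝ := (Metric.ball (0 : ℂ) 1).indicator singKernel with hK
  have hKm : Measurable K := measurable_singKernel.indicator measurableSet_ball
  have hK0 : ∀ y, 0 ≤ K y := fun y => indicator_nonneg (fun z _ => singKernel_nonneg z) y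
  have hKi : Integrable K :=
    (integrable_indicator_iff measurableSet_ball).2 integrableOn_singKernel_ball
  obtain ⟨δ, hδ0, hδ⟩ := exists_pos_setLIntegral_lt_of_measure_lt (μ := volume)
    (f := fun y => ENNReal.ofReal (K y)) (by
      rw [← ofReal_integral_eq_lintegral_ofReal hKi (Filter.Eventually.of_forall hK0)]
      exact ENNReal.ofReal_ne_top) (ε := ENNReal.ofReal (κ / 2)) (by simpa using hκ)
  obtain ⟨δ', hδ'0, hδ'⟩ : ∃ δ' : ℝ, 0 < δ' ∧ ENNReal.ofReal δ' ≤ δ := by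
    by_cases ht : δ = ⊤
    · exact ⟨1, one_pos, by simp [ht]⟩
    · exact ⟨δ.toReal, ENNReal.toReal_pos hδ0.ne' ht, by rw [ENNReal.ofReal_toReal ht]⟩
  refine ⟨min δ' (κ / 2), by positivity, fun E hE hEv x => ?_⟩
  have hEfin : volume E ≠ ⊤ := (hEv.trans ENNReal.ofReal_lt_top).ne
  have hEr : volume.real E ≤ κ / 2 := by
    refine (ENNReal.toReal_le_of_le_ofReal (by positivity) hEv.le).trans (min_le_right _ _)
  have hmp : MeasurePreserving (fun y : ℂ => x - y) volume volume :=
    MeasureTheory.Measure.measurePreserving_sub_left volume x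
  have hKxi : Integrable (fun y => K (x - y)) := integrable_indicator_singKernel_sub x
  have hpre : (fun y : ℂ => x - y) ⁻¹' ((fun y : ℂ => x - y) ⁻¹' E) = E := by
    ext y; simp
  have hint : ∫ y in E, K (x - y) ≤ κ / 2 := by
    have h2 : volume ((fun y : ℂ => x - y) ⁻¹' E) < δ := by
      rw [hmp.measure_preimage hE.nullMeasurableSet]
      exact hEv.trans_le ((ENNReal.ofReal_le_ofReal (min_le_left _ _)).trans hδ')
    have h3 := hδ _ h2
    have hm : Measurable fun y => K (x - y) := hKm.comp (measurable_const.sub measurable_id)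
    rw [integral_eq_lintegral_of_nonneg_ae (Filter.Eventually.of_forall fun y => hK0 _)
      hm.aestronglyMeasurable]
    refine ENNReal.toReal_le_of_le_ofReal (by positivity) ?_
    refine le_trans (le_of_eq ?_) h3.le
    rw [← hmp.setLIntegral_comp_preimage (hmp.measurable hE)
      (hKm.ennreal_ofReal), hpre]
  calc ∫ y in E, singKernel (x - y) ≤ ∫ y in E, (K (x - y) + 1) :=
        setIntegral_mono (integrableOn_singKernel_sub hEfin x)
          (hKxi.integrableOn.add (integrableOn_const hEfin))
          fun y => singKernel_le_indicator_add_one _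
    _ = (∫ y in E, K (x - y)) + volume.real E := by
        rw [integral_add hKxi.integrableOn (integrableOn_const hEfin)]; simp
    _ ≤ κ := by linarith

lemma norm_inv_le_singKernel (p : ℂ) : ‖p⁻¹‖ ≤ 1 + singKernel p := by
  unfold singKernel
  rw [norm_inv]
  rcases eq_or_ne p 0 with rfl | hp
  · simp
  have hs : 0 < √‖p‖ := Real.sqrt_pos.2 (norm_pos_iff.2 hp)
  have h2 : ‖p‖ = √‖p‖ ^ 2 := (Real.sq_sqrt (norm_nonneg _)).symm
  set s := √‖p‖
  rw [h2]
  rcases le_total s 1 with h | h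
  · have : (s ^ 2)⁻¹ ≤ (s ^ 3)⁻¹ := by
      apply inv_anti₀ (by positivity)
      nlinarith [sq_nonneg s]
    linarith
  · have : (s ^ 2)⁻¹ ≤ 1 := inv_le_one_of_one_le₀ (one_le_pow₀ h)
    have : 0 ≤ (s ^ 3)⁻¹ := by positivity
    linarith

lemma abs_log_norm_le_singKernel (p : ℂ) : |Real.log ‖p‖| ≤ ‖p‖ + (1 + singKernel p) := by
  rcases eq_or_ne p 0 with rfl | hp
  · simp [singKernel]
  have h0 : 0 < ‖p‖ := norm_pos_iff.2 hp
  have h1 := Real.log_le_sub_one_of_pos h0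
  have h2 := Real.log_le_sub_one_of_pos (inv_pos.2 h0)
  have h3 := norm_inv_le_singKernel p
  rw [norm_inv] at h3
  rw [Real.log_inv] at h2
  have := singKernel_nonneg p
  rw [abs_le]
  constructor <;> linarith

lemma norm_inv_sub_inv_le {p q : ℂ} (hp : p ≠ 0) (hq : q ≠ 0) :
    ‖p⁻¹ - q⁻¹‖ ≤ 2 * √‖p - q‖ * (singKernel p + singKernel q) := by
  unfold singKernel
  rw [inv_sub_inv hp hq, norm_div, norm_mul, norm_sub_rev q p]
  have hs : 0 < √‖p‖ := Real.sqrt_pos.2 (norm_pos_iff.2 hp)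
  have ht : 0 < √‖q‖ := Real.sqrt_pos.2 (norm_pos_iff.2 hq)
  have hs2 : √‖p‖ ^ 2 = ‖p‖ := Real.sq_sqrt (norm_nonneg _)
  have ht2 : √‖q‖ ^ 2 = ‖q‖ := Real.sq_sqrt (norm_nonneg _)
  have hu2 : √‖p - q‖ ^ 2 = ‖p - q‖ := Real.sq_sqrt (norm_nonneg _)
  have hu : 0 ≤ √‖p - q‖ := Real.sqrt_nonneg _
  have hle : √‖p - q‖ ≤ √‖p‖ + √‖q‖ := by
    rw [Real.sqrt_le_left (by positivity)]
    nlinarith [norm_sub_le p q]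
  nth_rewrite 1 [← hu2]
  nth_rewrite 1 [← hs2]
  nth_rewrite 1 [← ht2]
  generalize √‖p - q‖ = u at *
  generalize √‖p‖ = s at *
  generalize √‖q‖ = t at *
  have e : 2 * u * ((s ^ 3)⁻¹ + (t ^ 3)⁻¹) = u * (2 * (s ^ 3 + t ^ 3)) / (s ^ 3 * t ^ 3) := by
    field_simp; ring
  rw [e, div_le_div_iff₀ (by positivity) (by positivity)]
  have key : u * (s * t) ≤ 2 * (s ^ 3 + t ^ 3) := by
    have h1 : u * (s * t) ≤ (s + t) * (s * t) := by gcongr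
    have h2 : (s + t) * (s * t) ≤ s ^ 3 + t ^ 3 := by
      nlinarith [mul_nonneg (add_pos hs ht).le (sq_nonneg (s - t))]
    have : 0 < s ^ 3 + t ^ 3 := by positivity
    linarith
  calc u ^ 2 * (s ^ 3 * t ^ 3) = u * (s ^ 2 * t ^ 2) * (u * (s * t)) := by ring
    _ ≤ u * (s ^ 2 * t ^ 2) * (2 * (s ^ 3 + t ^ 3)) := by gcongr
    _ = _ := by ring

lemma abs_log_norm_taylor_le {p q : ℂ} (hp : p ≠ 0) (hq : q ≠ 0) :
    |Real.log ‖q‖ - Real.log ‖p‖ - ((q - p) * p⁻¹).re| ≤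
      4 * √‖q - p‖ ^ 3 * (singKernel p + singKernel q) := by
  unfold singKernel
  have hs : 0 < √‖p‖ := Real.sqrt_pos.2 (norm_pos_iff.2 hp)
  have ht : 0 < √‖q‖ := Real.sqrt_pos.2 (norm_pos_iff.2 hq)
  have hs2 : √‖p‖ ^ 2 = ‖p‖ := Real.sq_sqrt (norm_nonneg _)
  have ht2 : √‖q‖ ^ 2 = ‖q‖ := Real.sq_sqrt (norm_nonneg _)
  have hu2 : √‖q - p‖ ^ 2 = ‖q - p‖ := Real.sq_sqrt (norm_nonneg _)
  have hu : 0 ≤ √‖q - p‖ := Real.sqrt_nonneg _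
  have hτ : ‖(q - p) * p⁻¹‖ = √‖q - p‖ ^ 2 / √‖p‖ ^ 2 := by
    rw [norm_mul, norm_inv, hu2, hs2]; rfl
  by_cases hc : ‖q - p‖ ≤ ‖p‖ / 2
  · have hτ2 : ‖(q - p) * p⁻¹‖ ≤ 1 / 2 := by
      rw [norm_mul, norm_inv, ← div_eq_mul_inv, div_le_iff₀ (norm_pos_iff.2 hp)]; linarith
    have e1 : Real.log ‖q‖ - Real.log ‖p‖ = (Complex.log (1 + (q - p) * p⁻¹)).re := by
      rw [Complex.log_re, ← Real.log_div (norm_ne_zero_iff.2 hq) (norm_ne_zero_iff.2 hp),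
        ← norm_div]
      congr 2
      field_simp; ring
    rw [e1, ← Complex.sub_re]
    refine (Complex.abs_re_le_norm _).trans ?_
    refine (Complex.norm_log_one_add_sub_self_le (by linarith)).trans ?_
    have h1 : (1 - ‖(q - p) * p⁻¹‖)⁻¹ ≤ 2 := by
      rw [inv_le_comm₀ (by linarith) two_pos]; linarith
    have h2 : √‖q - p‖ / √‖p‖ ≤ 1 := by
      rw [div_le_one hs]
      exact Real.sqrt_le_sqrt (by linarith [norm_nonneg (q - p), norm_nonneg p])
    have h3 : ‖(q - p) * p⁻¹‖ ^ 2 * (1 - ‖(q - p) * p⁻¹‖)⁻¹ / 2 ≤ ‖(q - p) * p⁻¹‖ ^ 2 := by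
      nlinarith [sq_nonneg ‖(q - p) * p⁻¹‖]
    refine h3.trans ?_
    rw [hτ]
    generalize √‖q - p‖ = u at *
    generalize √‖p‖ = s at *
    generalize √‖q‖ = t at *
    have h4 : (u ^ 2 / s ^ 2) ^ 2 = (u / s) ^ 3 * (u / s) := by ring
    have h5 : 4 * u ^ 3 * ((s ^ 3)⁻¹ + (t ^ 3)⁻¹) = 4 * (u / s) ^ 3 + 4 * (u / t) ^ 3 := by ring
    rw [h4, h5]
    have h6 : 0 ≤ (u / s) ^ 3 := by positivity
    have h7 : 0 ≤ (u / t) ^ 3 := by positivity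
    nlinarith
  · push Not at hc
    have hre : |((q - p) * p⁻¹).re| ≤ √‖q - p‖ ^ 2 / √‖p‖ ^ 2 :=
      (Complex.abs_re_le_norm _).trans hτ.le
    have htri : √‖q‖ ^ 2 ≤ √‖p‖ ^ 2 + √‖q - p‖ ^ 2 := by
      rw [hs2, ht2, hu2]
      calc ‖q‖ = ‖p + (q - p)‖ := by congr 1; ring
        _ ≤ _ := norm_add_le _ _
    have hc' : √‖p‖ ^ 2 < 2 * √‖q - p‖ ^ 2 := by rw [hs2, hu2]; linarith
    generalize ((q - p) * p⁻¹).re = ρ at *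
    have hls : Real.log ‖p‖ = Real.log (√‖p‖ ^ 2) := by rw [hs2]
    have hlt : Real.log ‖q‖ = Real.log (√‖q‖ ^ 2) := by rw [ht2]
    rw [hls, hlt]
    clear hls hlt hs2 ht2 hu2 hc hτ
    generalize √‖q - p‖ = u at *
    generalize √‖p‖ = s at *
    generalize √‖q‖ = t at *
    have hu0 : 0 < u := by
      rcases hu.eq_or_lt with h | h
      · subst h; nlinarith
      · exact h
    have hsu : s ≤ 3 / 2 * u := by
      by_contra! h
      nlinarith
    have hA : u ^ 2 / s ^ 2 ≤ 3 / 2 * (u / s) ^ 3 := by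
      have : u / s * (2 / 3) ≥ 4 / 9 := by
        have : 2 / 3 ≤ u / s := by rw [le_div_iff₀ hs]; linarith
        linarith
      have h1 : (1 : ℝ) ≤ 3 / 2 * (u / s) := by linarith
      calc u ^ 2 / s ^ 2 = (u / s) ^ 2 * 1 := by ring
        _ ≤ (u / s) ^ 2 * (3 / 2 * (u / s)) := by gcongr
        _ = _ := by ring
    have hup : Real.log (t ^ 2) - Real.log (s ^ 2) ≤ u ^ 2 / s ^ 2 := by
      rw [← Real.log_div (by positivity) (by positivity)]
      refine (Real.log_le_sub_one_of_pos (by positivity)).trans ?_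
      rw [div_sub_one (by positivity)]
      gcongr
      linarith
    have hlow : Real.log (s ^ 2) - Real.log (t ^ 2) ≤ 2 * (4 * (u / t) ^ 3) / 3 := by
      have h1 : Real.log (s ^ 3 / t ^ 3) ≤ s ^ 3 / t ^ 3 := by
        have := Real.log_le_sub_one_of_pos (x := s ^ 3 / t ^ 3) (by positivity)
        linarith
      have h2 : s ^ 3 / t ^ 3 ≤ 4 * (u / t) ^ 3 := by
        have : s ^ 3 ≤ (3 / 2 * u) ^ 3 := by gcongr
        rw [div_pow, ← mul_div_assoc]
        gcongr
        nlinarith [pow_pos hu0 3]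
      rw [Real.log_div (by positivity) (by positivity), Real.log_pow, Real.log_pow] at h1
      rw [Real.log_pow, Real.log_pow]
      push_cast at *
      linarith
    have h5 : 4 * u ^ 3 * ((s ^ 3)⁻¹ + (t ^ 3)⁻¹) = 4 * (u / s) ^ 3 + 4 * (u / t) ^ 3 := by ring
    have h6 : 0 ≤ (u / s) ^ 3 := by positivity
    have h7 : 0 ≤ (u / t) ^ 3 := by positivity
    have h8 := abs_le.1 hre
    rw [h5, abs_le]
    constructor <;> linarith

lemma ae_ne_const_sub {E : Set ℂ} (x : ℂ) : ∀ᵐ y ∂(volume.restrict E), x - y ≠ 0 := by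
  have h : ∀ᵐ y : ℂ, y ≠ x := by
    simp [ae_iff, measure_singleton]
  filter_upwards [ae_restrict_of_ae h] with y hy
  exact sub_ne_zero.2 (Ne.symm hy)

lemma integrableOn_log_norm_sub {E : Set ℂ} (hE : MeasurableSet E) (hEb : Bornology.IsBounded E)
    (x : ℂ) : IntegrableOn (fun y => Real.log ‖x - y‖) E := by
  have hEfin : volume E ≠ ⊤ := hEb.measure_lt_top.ne
  obtain ⟨M, hM⟩ := hEb.exists_norm_le
  refine Integrable.mono' (g := fun y => (‖x‖ + M) + (1 + singKernel (x - y)))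
    ((integrableOn_const hEfin).add ((integrableOn_const hEfin).add
      (integrableOn_singKernel_sub hEfin x))) ?_ ?_
  · exact (by fun_prop : Measurable fun y => Real.log ‖x - y‖).aestronglyMeasurable
  · filter_upwards [ae_restrict_mem hE] with y hy
    refine (abs_log_norm_le_singKernel _).trans ?_
    have := hM y hy
    have := norm_sub_le x y
    linarith

lemma exists_logPotential_gradient_le {κ : ℝ} (hκ : 0 < κ) :
    ∃ δ : ℝ, 0 < δ ∧ ∀ E : Set ℂ, MeasurableSet E → Bornology.IsBounded E →
      volume E < ENNReal.ofReal δ →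
      ∃ V : ℂ → ℂ, (∀ x, ‖V x‖ ≤ κ) ∧
        (∀ x x', ‖V x - V x'‖ ≤ κ * √‖x - x'‖) ∧
        ∀ x x', |(∫ y in E, Real.log ‖x' - y‖) - (∫ y in E, Real.log ‖x - y‖)
          - ((x' - x) * V x).re| ≤ κ * √‖x' - x‖ ^ 3 := by
  obtain ⟨δ, hδ0, hδ⟩ := exists_setIntegral_singKernel_le (κ := κ / 8) (by positivity)
  refine ⟨min δ (κ / 2), by positivity, fun E hE hEb hEv => ?_⟩
  have hw := hδ E hE (hEv.trans_le (ENNReal.ofReal_le_ofReal (min_le_left _ _)))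
  have hEfin : volume E ≠ ⊤ := (hEv.trans ENNReal.ofReal_lt_top).ne
  have hwi := integrableOn_singKernel_sub hEfin
  have hEr : volume.real E ≤ κ / 2 :=
    (ENNReal.toReal_le_of_le_ofReal (by positivity) hEv.le).trans (min_le_right _ _)
  have hlog := integrableOn_log_norm_sub hE hEb
  have hinv : ∀ x, IntegrableOn (fun y => (x - y)⁻¹) E := by
    intro x
    refine Integrable.mono' (g := fun y => 1 + singKernel (x - y))
      ((integrableOn_const hEfin).add (hwi x)) ?_
      (Filter.Eventually.of_forall fun y => norm_inv_le_singKernel _)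
    exact (by fun_prop : Measurable fun y => (x - y)⁻¹).aestronglyMeasurable
  refine ⟨fun x => ∫ y in E, (x - y)⁻¹, fun x => ?_, fun x x' => ?_, fun x x' => ?_⟩
  · refine (norm_integral_le_of_norm_le (g := fun y => 1 + singKernel (x - y))
      ((integrableOn_const hEfin).add (hwi x))
      (Filter.Eventually.of_forall fun y => norm_inv_le_singKernel _)).trans ?_
    have e : (∫ y in E, (1 + singKernel (x - y))) = volume.real E + ∫ y in E, singKernel (x - y) := by
      have hc : IntegrableOn (fun _ : ℂ => (1 : ℝ)) E := integrableOn_const hEfin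
      rw [integral_add hc (hwi x)]
      simp
    rw [e]
    have := hw x
    linarith
  · rw [← integral_sub (hinv x) (hinv x')]
    have hi := ((hwi x).add (hwi x')).const_mul (2 * √‖x - x'‖)
    refine (norm_integral_le_of_norm_le hi ?_).trans ?_
    · filter_upwards [ae_ne_const_sub x, ae_ne_const_sub x'] with y h1 h2
      have := norm_inv_sub_inv_le h1 h2
      rwa [sub_sub_sub_cancel_right] at this
    · have e : (∫ y in E, 2 * √‖x - x'‖ * ((fun y => singKernel (x - y)) +
          fun y => singKernel (x' - y)) y) = 2 * √‖x - x'‖ *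
          ((∫ y in E, singKernel (x - y)) + ∫ y in E, singKernel (x' - y)) := by
        rw [integral_const_mul, ← integral_add (hwi x) (hwi x')]; rfl
      rw [e]
      have := hw x
      have := hw x'
      have := Real.sqrt_nonneg ‖x - x'‖
      nlinarith
  · have hre : ((x' - x) * ∫ y in E, (x - y)⁻¹).re = ∫ y in E, ((x' - x) * (x - y)⁻¹).re := by
      rw [← integral_const_mul]
      exact (integral_re ((hinv x).const_mul (x' - x))).symm
    have hrei : IntegrableOn (fun y => ((x' - x) * (x - y)⁻¹).re) E :=
      ((hinv x).const_mul (x' - x)).re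
    rw [hre, ← integral_sub (hlog x') (hlog x), ← integral_sub (f := fun y => Real.log ‖x' - y‖ - Real.log ‖x - y‖)
      ((hlog x').sub (hlog x)) hrei]
    have hi := ((hwi x).add (hwi x')).const_mul (4 * √‖x' - x‖ ^ 3)
    rw [← Real.norm_eq_abs]
    refine (norm_integral_le_of_norm_le hi ?_).trans ?_
    · filter_upwards [ae_ne_const_sub x, ae_ne_const_sub x'] with y h1 h2
      have := abs_log_norm_taylor_le h1 h2
      rwa [sub_sub_sub_cancel_right] at this
    · have e : (∫ y in E, 4 * √‖x' - x‖ ^ 3 * ((fun y => singKernel (x - y)) +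
          fun y => singKernel (x' - y)) y) = 4 * √‖x' - x‖ ^ 3 *
          ((∫ y in E, singKernel (x - y)) + ∫ y in E, singKernel (x' - y)) := by
        rw [integral_const_mul, ← integral_add (hwi x) (hwi x')]; rfl
      rw [e]
      have := hw x
      have := hw x'
      have : 0 ≤ √‖x' - x‖ ^ 3 := by positivity
      nlinarith

/-- The radial profile of the logarithmic potential of the unit disk. -/
noncomputable def diskProfile (r : ℝ) : ℝ :=
  if r ≤ 1 then (r ^ 2 - 1) / 4 else Real.log r / 2

lemma hasDerivAt_diskProfile {r : ℝ} (hr : 0 < r) :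
    HasDerivAt diskProfile (min r r⁻¹ / 2) r := by
  have h1 : HasDerivAt (fun r : ℝ => (r ^ 2 - 1) / 4) (r / 2) r := by
    have := (((hasDerivAt_id r).pow 2).sub_const 1).div_const 4
    refine this.congr_deriv ?_
    simp; ring
  have h2 : HasDerivAt (fun r : ℝ => Real.log r / 2) (r⁻¹ / 2) r :=
    (Real.hasDerivAt_log hr.ne').div_const 2
  rcases lt_trichotomy r 1 with h | h | h
  · have : min r r⁻¹ = r := min_eq_left (h.le.trans ((one_le_inv₀ hr).2 h.le))
    rw [this]
    refine h1.congr_of_eventuallyEq ?_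
    filter_upwards [gt_mem_nhds h] with x hx
    simp [diskProfile, hx.le]
  · subst h
    have e : min (1 : ℝ) 1⁻¹ / 2 = 1 / 2 := by simp
    rw [e]
    have h3 : HasDerivWithinAt diskProfile (1 / 2) (Iic 1) 1 := by
      refine h1.hasDerivWithinAt.congr (fun x hx => ?_) ?_
      · simp only [diskProfile, if_pos (mem_Iic.1 hx)]
      · simp [diskProfile]
    have h4 : HasDerivWithinAt diskProfile (1 / 2) (Ici 1) 1 := by
      refine (h2.hasDerivWithinAt.congr (fun x hx => ?_) ?_).congr_deriv (by simp)
      · rcases (mem_Ici.1 hx).eq_or_lt with h | h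
        · subst h; simp [diskProfile]
        · simp [diskProfile, h]
      · simp [diskProfile]
    have := h3.union h4
    rwa [Iic_union_Ici, hasDerivWithinAt_univ] at this
  · have : min r r⁻¹ = r⁻¹ := min_eq_right ((inv_le_one_of_one_le₀ h.le).trans h.le)
    rw [this]
    refine h2.congr_of_eventuallyEq ?_
    filter_upwards [lt_mem_nhds h] with x hx
    simp [diskProfile, hx]

lemma integral_angle_log_norm_sub (x : ℂ) {r : ℝ} (hr : 0 < r) :
    ∫ θ in Ioo (-Real.pi) Real.pi, Real.log ‖x - Complex.polarCoord.symm (r, θ)‖ =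
      2 * Real.pi * Real.log (max r ‖x‖) := by
  have h := circleAverage_log_norm_sub_const_eq_log_radius_add_posLog (c := 0) (a := x) hr.ne'
  have hper : Function.Periodic (fun θ => Real.log ‖circleMap 0 r θ - x‖) (2 * Real.pi) := by
    intro θ
    simp only [periodic_circleMap 0 r θ]
  have h2 : ∫ θ in Ioo (-Real.pi) Real.pi, Real.log ‖x - Complex.polarCoord.symm (r, θ)‖ =
      ∫ θ in (0 : ℝ)..(2 * Real.pi), Real.log ‖circleMap 0 r θ - x‖ := by
    have := hper.intervalIntegral_add_eq (-Real.pi) 0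
    rw [zero_add, (by ring : -Real.pi + 2 * Real.pi = Real.pi)] at this
    rw [← this, intervalIntegral.integral_of_le (by linarith [Real.pi_pos]),
      ← integral_Ioc_eq_integral_Ioo]
    refine integral_congr_ae (Filter.Eventually.of_forall fun θ => ?_)
    simp only
    rw [norm_sub_rev]
    congr 3
    rw [Complex.polarCoord_symm_apply, circleMap, Complex.exp_mul_I]
    simp
  rw [h2]
  rw [Real.circleAverage_def, smul_eq_mul, inv_mul_eq_iff_eq_mul₀ (by positivity)] at h
  rw [h]
  congr 1
  rw [zero_sub, norm_neg]
  rcases eq_or_ne x 0 with rfl | hx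
  · simp [hr.le]
  have hx0 : 0 < ‖x‖ := norm_pos_iff.2 hx
  rcases le_total r ‖x‖ with hle | hle
  · rw [max_eq_right hle, Real.posLog_eq_log, Real.log_mul (by positivity) hx0.ne', Real.log_inv]
    · ring
    · rw [abs_of_pos (by positivity), inv_mul_eq_div, one_le_div hr]; exact hle
  · rw [max_eq_left hle, (Real.posLog_eq_zero_iff _).2, add_zero]
    rw [abs_of_pos (by positivity), inv_mul_eq_div, div_le_one hr]; exact hle

lemma integral_radius_mul_log (a : ℝ) (ha : 0 ≤ a) :
    ∫ r in (0 : ℝ)..1, r * Real.log (max r a) = diskProfile a := by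
  have key : ∀ b, 0 ≤ b → b ≤ 1 → ∫ r in b..1, r * Real.log r =
      -1 / 4 - b ^ 2 * Real.log b / 2 + b ^ 2 / 4 := by
    intro b hb hb1
    have hc : Continuous fun r : ℝ => r * Real.log r := Real.continuous_mul_log
    have := intervalIntegral.integral_eq_sub_of_hasDeriv_right_of_le hb1
      (f := fun r => r * (r * Real.log r) / 2 - r ^ 2 / 4) (f' := fun r => r * Real.log r)
      (by fun_prop) (fun r hr => ?_) (hc.intervalIntegrable _ _)
    · rw [this]; simp; ring
    · have hr0 : r ≠ 0 := (hb.trans_lt hr.1).ne'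
      have h1 := (((hasDerivAt_id r).mul ((hasDerivAt_id r).mul (Real.hasDerivAt_log hr0))).div_const
        2).sub (((hasDerivAt_id r).pow 2).div_const 4)
      refine (h1.congr_deriv ?_).hasDerivWithinAt
      simp
      field_simp
      ring
  have hconst : ∀ b c : ℝ, ∫ r in (0 : ℝ)..b, r * c = b ^ 2 / 2 * c := by
    intro b c
    rw [intervalIntegral.integral_mul_const, integral_id]; ring
  rcases le_total a 1 with h | h
  · have h0 : ∫ r in (0 : ℝ)..a, r * Real.log (max r a) = ∫ r in (0 : ℝ)..a, r * Real.log a := by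
      refine intervalIntegral.integral_congr fun r hr => ?_
      rw [uIcc_of_le ha] at hr
      simp only [max_eq_right hr.2]
    have h1 : ∫ r in a..1, r * Real.log (max r a) = ∫ r in a..1, r * Real.log r := by
      refine intervalIntegral.integral_congr fun r hr => ?_
      rw [uIcc_of_le h] at hr
      simp only [max_eq_left hr.1]
    have hi0 : IntervalIntegrable (fun r => r * Real.log (max r a)) volume 0 a := by
      refine IntervalIntegrable.congr (f := fun r => r * Real.log a) ?_
        (Continuous.intervalIntegrable (by fun_prop) _ _)
      intro r hr
      rw [uIoc_of_le ha] at hr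
      simp only [max_eq_right hr.2]
    have hi1 : IntervalIntegrable (fun r => r * Real.log (max r a)) volume a 1 := by
      refine IntervalIntegrable.congr (f := fun r => r * Real.log r) ?_
        (Real.continuous_mul_log.intervalIntegrable _ _)
      intro r hr
      rw [uIoc_of_le h] at hr
      simp only [max_eq_left hr.1.le]
    rw [← intervalIntegral.integral_add_adjacent_intervals hi0 hi1, h0, h1, hconst, key a ha h,
      diskProfile, if_pos h]
    ring
  · have h0 : ∫ r in (0 : ℝ)..1, r * Real.log (max r a) = ∫ r in (0 : ℝ)..1, r * Real.log a := by
      refine intervalIntegral.integral_congr fun r hr => ?_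
      rw [uIcc_of_le zero_le_one] at hr
      simp only [max_eq_right (hr.2.trans h)]
    rw [h0, hconst, diskProfile]
    split_ifs with h1
    · have : a = 1 := le_antisymm h1 h
      subst this; simp
    · ring

lemma integral_unitDisk_log_norm_sub (x : ℂ) :
    ∫ y in Metric.ball (0 : ℂ) 1, Real.log ‖x - y‖ = 2 * Real.pi * diskProfile ‖x‖ := by
  set f : ℂ → ℝ := (Metric.ball (0 : ℂ) 1).indicator fun y => Real.log ‖x - y‖ with hf
  have hfm : Measurable f := (by fun_prop : Measurable fun y => Real.log ‖x - y‖).indicator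
    measurableSet_ball
  have hfi : Integrable f := (integrable_indicator_iff measurableSet_ball).2
    (integrableOn_log_norm_sub measurableSet_ball Metric.isBounded_ball x)
  have hpm : Measurable fun p : ℝ × ℝ => Complex.polarCoord.symm p := by
    simp only [Complex.polarCoord_symm_apply]
    fun_prop
  have hgi : IntegrableOn (fun p : ℝ × ℝ => p.1 • f (Complex.polarCoord.symm p))
      (Ioi 0 ×ˢ Ioo (-Real.pi) Real.pi) := by
    refine ⟨(by fun_prop : Measurable fun p : ℝ × ℝ =>
      p.1 • f (Complex.polarCoord.symm p)).aestronglyMeasurable, ?_⟩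
    have h := Complex.lintegral_comp_polarCoord_symm fun y => ‖f y‖ₑ
    have hlt : ∫⁻ y, ‖f y‖ₑ < ⊤ := hfi.2
    rw [← h] at hlt
    refine lt_of_le_of_lt (le_of_eq ?_) hlt
    refine setLIntegral_congr_fun (measurableSet_Ioi.prod measurableSet_Ioo) fun p hp => ?_
    simp only [smul_eq_mul, enorm_mul]
    rw [Real.enorm_of_nonneg (le_of_lt hp.1)]
  rw [← integral_indicator measurableSet_ball, ← hf, ← Complex.integral_comp_polarCoord_symm f]
  change ∫ p in Ioi 0 ×ˢ Ioo (-Real.pi) Real.pi, _ = _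
  rw [Measure.volume_eq_prod, setIntegral_prod _ hgi]
  have h1 : ∀ r ∈ Ioi (0 : ℝ), (∫ θ in Ioo (-Real.pi) Real.pi,
      (r, θ).1 • f (Complex.polarCoord.symm (r, θ))) =
      (Iio (1 : ℝ)).indicator (fun r => 2 * Real.pi * (r * Real.log (max r ‖x‖))) r := by
    intro r hr
    have hmem : ∀ θ, Complex.polarCoord.symm (r, θ) ∈ Metric.ball (0 : ℂ) 1 ↔ r < 1 := by
      intro θ
      rw [mem_ball_zero_iff, Complex.norm_polarCoord_symm, abs_of_pos hr]
    by_cases h : r < 1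
    · rw [indicator_of_mem (mem_Iio.2 h)]
      simp only [hf, indicator_of_mem ((hmem _).2 h), smul_eq_mul]
      rw [integral_const_mul, integral_angle_log_norm_sub x hr]
      ring
    · rw [indicator_of_notMem (by simpa using h)]
      simp only [hf, indicator_of_notMem (mt (hmem _).1 h), smul_zero, integral_zero]
  rw [setIntegral_congr_fun measurableSet_Ioi h1, setIntegral_indicator measurableSet_Iio,
    Ioi_inter_Iio, ← integral_Ioc_eq_integral_Ioo, ← intervalIntegral.integral_of_le zero_le_one,
    intervalIntegral.integral_const_mul, integral_radius_mul_log _ (norm_nonneg _)]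

/-- `h` is a potential with complex gradient `V`, all of whose relevant norms are at most `κ`. -/
structure IsSmallPotential (κ : ℝ) (h : ℂ → ℝ) (V : ℂ → ℂ) : Prop where
  norm_le : ∀ x, ‖V x‖ ≤ κ
  holder : ∀ x x', ‖V x - V x'‖ ≤ κ * √‖x - x'‖
  taylor : ∀ x x', |h x' - h x - ((x' - x) * V x).re| ≤ κ * √‖x' - x‖ ^ 3

lemma exists_relStream_eq_add_smallPotential {κ : ℝ} (hκ : 0 < κ) :
    ∃ δ : ℝ, 0 < δ ∧ ∀ D : Set ℂ, IsOpen D → Bornology.IsBounded D →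
      volume (symmDiff (Metric.ball (0 : ℂ) 1) D) < ENNReal.ofReal δ →
      ∃ h V, IsSmallPotential κ h V ∧
        ∀ Ω x, relStream D Ω x = diskProfile ‖x‖ - Ω * ‖x‖ ^ 2 / 2 + h x := by
  obtain ⟨δ, hδ0, hδ⟩ := exists_logPotential_gradient_le hκ
  refine ⟨δ, hδ0, fun D hDo hDb hv => ?_⟩
  set B := Metric.ball (0 : ℂ) 1 with hB
  have hBm : MeasurableSet B := measurableSet_ball
  have hBb : Bornology.IsBounded B := Metric.isBounded_ball
  obtain ⟨V₁, a₁, b₁, c₁⟩ := hδ (D \ B) (hDo.measurableSet.diff hBm) (hDb.subset sdiff_subset)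
    ((measure_mono (subset_union_right)).trans_lt hv)
  obtain ⟨V₂, a₂, b₂, c₂⟩ := hδ (B \ D) (hBm.diff hDo.measurableSet) (hBb.subset sdiff_subset)
    ((measure_mono (subset_union_left)).trans_lt hv)
  have hπ : 0 < 1 / (2 * Real.pi) := by positivity
  have hπ2 : 1 / (2 * Real.pi) * 2 ≤ 1 := by
    rw [one_div_mul_eq_div, div_le_one (by positivity)]; linarith [Real.pi_gt_three]
  have hle : ∀ M s t : ℝ, 0 ≤ M → s ≤ M → t ≤ M → 1 / (2 * Real.pi) * (s + t) ≤ M := by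
    intro M s t hM hs ht
    calc 1 / (2 * Real.pi) * (s + t) ≤ 1 / (2 * Real.pi) * (M + M) := by gcongr
      _ = (1 / (2 * Real.pi) * 2) * M := by ring
      _ ≤ 1 * M := by gcongr
      _ = M := one_mul M
  have hnorm : ∀ z w : ℂ, ‖((1 / (2 * Real.pi) : ℝ) : ℂ) * (z - w)‖ ≤
      1 / (2 * Real.pi) * (‖z‖ + ‖w‖) := by
    intro z w
    rw [norm_mul, Complex.norm_real, Real.norm_of_nonneg hπ.le]
    gcongr
    exact norm_sub_le _ _
  refine ⟨fun x => 1 / (2 * Real.pi) * ((∫ y in D \ B, Real.log ‖x - y‖) -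
    ∫ y in B \ D, Real.log ‖x - y‖), fun x => ((1 / (2 * Real.pi) : ℝ) : ℂ) * (V₁ x - V₂ x),
    ⟨fun x => ?_, fun x x' => ?_, fun x x' => ?_⟩, fun Ω x => ?_⟩
  · exact (hnorm _ _).trans (hle _ _ _ hκ.le (a₁ x) (a₂ x))
  · rw [← mul_sub, (by ring : V₁ x - V₂ x - (V₁ x' - V₂ x') = V₁ x - V₁ x' - (V₂ x - V₂ x'))]
    exact (hnorm _ _).trans (hle _ _ _ (by positivity) (b₁ x x') (b₂ x x'))
  · have e : ((x' - x) * (((1 / (2 * Real.pi) : ℝ) : ℂ) * (V₁ x - V₂ x))).re =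
        1 / (2 * Real.pi) * (((x' - x) * V₁ x).re - ((x' - x) * V₂ x).re) := by
      rw [← Complex.sub_re, ← mul_sub, ← Complex.re_ofReal_mul]
      congr 1; ring
    rw [e, ← mul_sub, ← mul_sub, abs_mul, abs_of_pos hπ]
    refine le_trans ?_ (hle _ _ _ (by positivity) (c₁ x x') (c₂ x x'))
    gcongr
    refine le_trans (le_of_eq ?_) (abs_sub _ _)
    congr 1; ring
  · have i1 := integral_inter_add_sdiff hBm (integrableOn_log_norm_sub hDo.measurableSet hDb x)
    have i2 := integral_inter_add_sdiff hDo.measurableSet (integrableOn_log_norm_sub hBm hBb x)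
    rw [integral_unitDisk_log_norm_sub, inter_comm] at i2
    have e : diskProfile ‖x‖ = 1 / (2 * Real.pi) * (2 * Real.pi * diskProfile ‖x‖) := by
      field_simp
    rw [relStream, ← i1, e, ← i2]
    ring

lemma IsSmallPotential.abs_sub_le {κ : ℝ} {h : ℂ → ℝ} {V : ℂ → ℂ} (H : IsSmallPotential κ h V)
    {x x' : ℂ} (hx : ‖x' - x‖ ≤ 4) : |h x' - h x| ≤ 3 * κ * ‖x' - x‖ := by
  have hκ : 0 ≤ κ := (norm_nonneg _).trans (H.norm_le x)
  have h1 := H.taylor x x'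
  have h2 : |((x' - x) * V x).re| ≤ ‖x' - x‖ * κ := by
    refine (Complex.abs_re_le_norm _).trans ?_
    rw [norm_mul]
    gcongr
    exact H.norm_le x
  have h3 : √‖x' - x‖ ^ 3 ≤ 2 * ‖x' - x‖ := by
    have h4 : √‖x' - x‖ ≤ 2 := by
      rw [Real.sqrt_le_left two_pos.le]; linarith
    calc √‖x' - x‖ ^ 3 = √‖x' - x‖ * √‖x' - x‖ ^ 2 := by ring
      _ ≤ 2 * √‖x' - x‖ ^ 2 := by gcongr
      _ = _ := by rw [Real.sq_sqrt (norm_nonneg _)]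
  have h5 : κ * √‖x' - x‖ ^ 3 ≤ κ * (2 * ‖x' - x‖) := by gcongr
  rw [abs_le] at *
  constructor <;> linarith

/-- The relative stream function of the unit disk rotating with angular velocity `Ω`, as a function
of the radius. -/
noncomputable def radialStream (Ω r : ℝ) : ℝ := diskProfile r - Ω * r ^ 2 / 2

/-- The derivative of `radialStream Ω`. -/
noncomputable def radialStreamDeriv (Ω r : ℝ) : ℝ := min r r⁻¹ / 2 - Ω * r

lemma hasDerivAt_radialStream (Ω : ℝ) {r : ℝ} (hr : 0 < r) :
    HasDerivAt (radialStream Ω) (radialStreamDeriv Ω r) r := by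
  have h := (((hasDerivAt_id r).pow 2).const_mul Ω).div_const 2
  refine ((hasDerivAt_diskProfile hr).sub h).congr_deriv ?_
  simp only [radialStreamDeriv, id]
  push_cast
  ring

lemma le_radialStreamDeriv {Ω r : ℝ} (hΩ : |Ω - 1 / 4| ≤ 1 / 100) (h1 : 9 / 10 ≤ r)
    (h2 : r ≤ 6 / 5) : 1 / 10 ≤ radialStreamDeriv Ω r := by
  have hr : 0 < r := by linarith
  obtain ⟨ha, hb⟩ := abs_le.1 hΩ
  have hΩr : Ω * r ≤ 26 / 100 * r := by gcongr; linarith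
  unfold radialStreamDeriv
  rcases min_choice r r⁻¹ with h | h <;> rw [h]
  · linarith
  · have : (6 / 5 : ℝ)⁻¹ ≤ r⁻¹ := inv_anti₀ hr h2
    norm_num at this
    linarith

lemma abs_radialStreamDeriv_sub_le {Ω r s : ℝ} (hΩ : |Ω - 1 / 4| ≤ 1 / 100) (hr : 9 / 10 ≤ r)
    (hs : 9 / 10 ≤ s) : |radialStreamDeriv Ω r - radialStreamDeriv Ω s| ≤ 2 * |r - s| := by
  have hr0 : 0 < r := by linarith
  have hs0 : 0 < s := by linarith
  obtain ⟨ha, hb⟩ := abs_le.1 hΩ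
  have h1 : |r⁻¹ - s⁻¹| ≤ 2 * |r - s| := by
    rw [inv_sub_inv hr0.ne' hs0.ne', abs_div, abs_of_pos (mul_pos hr0 hs0), abs_sub_comm s r,
      div_le_iff₀ (by positivity)]
    have : 1 ≤ 2 * (r * s) := by nlinarith
    nlinarith [abs_nonneg (r - s)]
  have h2 : |min r r⁻¹ - min s s⁻¹| ≤ 2 * |r - s| :=
    (abs_min_sub_min_le_max _ _ _ _).trans (max_le (by linarith [abs_nonneg (r - s)]) h1)
  have h3 : |Ω * (r - s)| ≤ 1 * |r - s| := by
    rw [abs_mul]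
    gcongr
    rw [abs_le]; constructor <;> linarith
  have e : radialStreamDeriv Ω r - radialStreamDeriv Ω s =
    (min r r⁻¹ - min s s⁻¹) / 2 - Ω * (r - s) := by unfold radialStreamDeriv; ring
  rw [e]
  rw [abs_le] at *
  constructor <;> linarith

lemma sub_div_le_radialStream_sub {Ω r s : ℝ} (hΩ : |Ω - 1 / 4| ≤ 1 / 100) (hs : 9 / 10 ≤ s)
    (h : s ≤ r) (hr : r ≤ 6 / 5) : (r - s) / 10 ≤ radialStream Ω r - radialStream Ω s := by
  have hd : ∀ t ∈ Icc (9 / 10 : ℝ) (6 / 5),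
      HasDerivAt (radialStream Ω) (radialStreamDeriv Ω t) t := fun t ht =>
    hasDerivAt_radialStream Ω (by linarith [ht.1])
  have := (convex_Icc (9 / 10 : ℝ) (6 / 5)).mul_sub_le_image_sub_of_le_deriv (f := radialStream Ω)
    (C := 1 / 10) (fun t ht => (hd t ht).continuousAt.continuousWithinAt)
    (fun t ht => (hd t (interior_subset ht)).differentiableAt.differentiableWithinAt)
    (fun t ht => by
      have ht := interior_subset ht
      rw [(hd t ht).deriv]
      exact le_radialStreamDeriv hΩ ht.1 ht.2) s ⟨hs, h.trans hr⟩ r ⟨hs.trans h, hr⟩ h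
  linarith

lemma abs_sub_div_le_radialStream_sub {Ω r s : ℝ} (hΩ : |Ω - 1 / 4| ≤ 1 / 100)
    (hr : r ∈ Icc (9 / 10) (6 / 5)) (hs : s ∈ Icc (9 / 10) (6 / 5)) :
    |r - s| / 10 ≤ |radialStream Ω r - radialStream Ω s| := by
  wlog h : s ≤ r generalizing r s
  · rw [abs_sub_comm r, abs_sub_comm (radialStream Ω r)]
    exact this hs hr (le_of_not_ge h)
  rw [abs_of_nonneg (sub_nonneg.2 h)]
  exact (sub_div_le_radialStream_sub hΩ hs.1 h hr.2).trans (le_abs_self _)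

lemma radialStream_le_of_le {Ω r : ℝ} (hΩ : |Ω - 1 / 4| ≤ 1 / 100) (h0 : 0 ≤ r)
    (hr : r ≤ 9 / 10) : radialStream Ω r ≤ radialStream Ω (9 / 10) := by
  obtain ⟨ha, hb⟩ := abs_le.1 hΩ
  rw [radialStream, radialStream, diskProfile, diskProfile, if_pos (by linarith),
    if_pos (by norm_num)]
  have : r ^ 2 ≤ (9 / 10) ^ 2 := by gcongr
  nlinarith

lemma inter_frontier_nonempty_of_isPreconnected {S D : Set ℂ} (hS : IsPreconnected S)
    (h1 : (S ∩ D).Nonempty) (h2 : (S ∩ Dᶜ).Nonempty) : (S ∩ frontier D).Nonempty := by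
  by_contra hne
  rw [not_nonempty_iff_eq_empty] at hne
  have hsub : S ⊆ interior D ∪ (closure D)ᶜ := by
    intro x hx
    by_contra hx'
    simp only [mem_union, mem_compl_iff, not_or, not_not] at hx'
    have : x ∈ S ∩ frontier D := ⟨hx, hx'.2, hx'.1⟩
    rw [hne] at this
    exact this
  obtain ⟨x, hxS, hxD⟩ := h1
  obtain ⟨y, hyS, hyD⟩ := h2
  obtain ⟨z, -, hz1, hz2⟩ := hS _ _ isOpen_interior isClosed_closure.isOpen_compl hsub
    ⟨x, hxS, (hsub hxS).resolve_right fun h => h (subset_closure hxD)⟩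
    ⟨y, hyS, (hsub hyS).resolve_left fun h => hyD (interior_subset h)⟩
  exact hz2 (subset_closure (interior_subset hz1))

lemma isPreconnected_annulus {a b : ℝ} (ha : 0 ≤ a) :
    IsPreconnected {x : ℂ | a < ‖x‖ ∧ ‖x‖ < b} := by
  have h : IsPreconnected ((fun p : ℝ × ℝ => (p.1 : ℂ) * Complex.exp (p.2 * Complex.I)) ''
      (Ioo a b ×ˢ univ)) :=
    (isPreconnected_Ioo.prod isPreconnected_univ).image _ (by fun_prop)
  convert h using 1
  ext x
  constructor
  · intro hx
    exact ⟨(‖x‖, x.arg), ⟨hx, mem_univ _⟩, Complex.norm_mul_exp_arg_mul_I x⟩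
  · rintro ⟨p, ⟨hp, -⟩, rfl⟩
    have h0 : 0 < p.1 := ha.trans_lt hp.1
    simpa [Complex.norm_exp_ofReal_mul_I, abs_of_pos h0] using hp

lemma frontier_near_circle {κ η Ω c : ℝ} {h : ℂ → ℝ} {V : ℂ → ℂ} {D : Set ℂ}
    (H : IsSmallPotential κ h V) (hη : η ≤ 1 / 40) (hκη : κ ≤ η / 1000) (hη0 : 0 < η)
    (hΩ : |Ω - 1 / 4| ≤ 1 / 100) (hDc : IsPreconnected D)
    (hc : ∀ x ∈ frontier D, radialStream Ω ‖x‖ + h x = c)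
    (hp₁ : ∃ p ∈ D, 1 - η < ‖p‖ ∧ ‖p‖ < 1 + η) (hp₂ : ∃ p, p ∉ D ∧ 1 - η < ‖p‖ ∧ ‖p‖ < 1 + η)
    (hq₁ : ∃ q ∈ D, ‖q‖ < 1 / 2) (hq₂ : ∃ q, q ∉ D ∧ 11 / 10 < ‖q‖ ∧ ‖q‖ < 6 / 5) :
    (∀ x ∈ frontier D, |‖x‖ - 1| ≤ 2 * η) ∧ (0 : ℂ) ∈ D ∧ ∀ x ∈ D, ‖x‖ < 6 / 5 := by
  obtain ⟨p₁, hp₁D, hp₁⟩ := hp₁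
  obtain ⟨p₂, hp₂D, hp₂⟩ := hp₂
  obtain ⟨q₁, hq₁D, hq₁⟩ := hq₁
  obtain ⟨q₂, hq₂D, hq₂⟩ := hq₂
  obtain ⟨x₀, ⟨hx₀l, hx₀r⟩, hx₀D⟩ := inter_frontier_nonempty_of_isPreconnected
    (isPreconnected_annulus (a := 1 - η) (b := 1 + η) (by linarith)) ⟨p₁, hp₁, hp₁D⟩
    ⟨p₂, hp₂, hp₂D⟩
  have hnear : ∀ x ∈ frontier D, ‖x‖ < 6 / 5 → |‖x‖ - 1| ≤ 2 * η := by
    intro x hx hx5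
    have e : radialStream Ω ‖x‖ - radialStream Ω ‖x₀‖ = -(h x - h x₀) := by
      linarith [hc x hx, hc x₀ hx₀D]
    have hd : ‖x - x₀‖ ≤ 9 / 4 := (norm_sub_le _ _).trans (by linarith)
    have hκ : 0 ≤ κ := (norm_nonneg _).trans (H.norm_le x)
    have hh : |h x - h x₀| ≤ 7 * κ := by
      refine (H.abs_sub_le (by linarith)).trans ?_
      nlinarith
    have hG : |radialStream Ω ‖x‖ - radialStream Ω ‖x₀‖| ≤ 7 * κ := by
      rwa [e, abs_neg]
    rcases le_total (9 / 10) ‖x‖ with hr | hr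
    · have := abs_sub_div_le_radialStream_sub hΩ (r := ‖x‖) (s := ‖x₀‖) ⟨hr, hx5.le⟩
        ⟨by linarith, by linarith⟩
      have h2 : |‖x‖ - ‖x₀‖| ≤ η := by linarith
      rw [abs_le] at h2 ⊢
      constructor <;> linarith
    · have h1 := radialStream_le_of_le hΩ (norm_nonneg x) hr
      have h2 := sub_div_le_radialStream_sub hΩ (s := 9 / 10) (r := ‖x₀‖) le_rfl (by linarith)
        (by linarith)
      have h3 := (abs_le.1 hG).1
      linarith
  have h0 : (0 : ℂ) ∈ D := by
    by_contra h0
    obtain ⟨x, hxb, hx⟩ := inter_frontier_nonempty_of_isPreconnected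
      (convex_ball (0 : ℂ) (1 / 2)).isPreconnected ⟨q₁, by simpa using hq₁, hq₁D⟩
      ⟨0, by simp, h0⟩
    have hxn : ‖x‖ < 1 / 2 := by simpa using hxb
    have := (abs_le.1 (hnear x hx (by linarith))).1
    linarith
  have hout : ∀ x ∈ D, ‖x‖ ≤ 11 / 10 := by
    intro x hx
    by_contra! hx1
    obtain ⟨y, hyD, hy⟩ : ∃ y ∈ D, 11 / 10 < ‖y‖ ∧ ‖y‖ < 6 / 5 := by
      have hI : IsPreconnected ((fun z : ℂ => ‖z‖) '' D) :=
        hDc.image _ continuous_norm.continuousOn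
      have h1 : min ‖x‖ (23 / 20) ∈ (fun z : ℂ => ‖z‖) '' D :=
        hI.ordConnected.out ⟨0, h0, norm_zero⟩ ⟨x, hx, rfl⟩
          ⟨by positivity, min_le_left _ _⟩
      obtain ⟨y, hyD, hy⟩ := h1
      refine ⟨y, hyD, ?_, ?_⟩
      · change ‖y‖ = _ at hy
        rw [hy]; exact lt_min hx1 (by norm_num)
      · change ‖y‖ = _ at hy
        rw [hy]; exact (min_le_right _ _).trans_lt (by norm_num)
    obtain ⟨z, hzb, hz⟩ := inter_frontier_nonempty_of_isPreconnected
      (isPreconnected_annulus (a := 11 / 10) (b := 6 / 5) (by norm_num)) ⟨y, hy, hyD⟩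
      ⟨q₂, hq₂, hq₂D⟩
    have := (abs_le.1 (hnear z hz hzb.2)).2
    linarith [hzb.1]
  refine ⟨fun x hx => hnear x hx ?_, h0, fun x hx => (hout x hx).trans_lt (by norm_num)⟩
  have hcl : closure D ⊆ {x : ℂ | ‖x‖ ≤ 11 / 10} :=
    closure_minimal hout (isClosed_le continuous_norm continuous_const)
  have : ‖x‖ ≤ 11 / 10 := hcl (frontier_subset_closure hx)
  linarith

lemma exists_mem_frontier_ray {D : Set ℂ} (h0 : (0 : ℂ) ∈ D) (hD : ∀ x ∈ D, ‖x‖ < 6 / 5) (θ : ℝ) :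
    ∃ r : ℝ, 0 ≤ r ∧ (r : ℂ) * Complex.exp (θ * Complex.I) ∈ frontier D := by
  have hS : IsPreconnected ((fun r : ℝ => (r : ℂ) * Complex.exp (θ * Complex.I)) '' Ici 0) :=
    isPreconnected_Ici.image _ (by fun_prop)
  obtain ⟨x, ⟨r, hr, rfl⟩, hx⟩ := inter_frontier_nonempty_of_isPreconnected hS
    ⟨0, ⟨0, by simp, by simp⟩, h0⟩
    ⟨((2 : ℝ) : ℂ) * Complex.exp (θ * Complex.I), ⟨2, by simp, rfl⟩, fun hmem => by
      have := hD _ hmem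
      rw [norm_mul, Complex.norm_exp_ofReal_mul_I] at this
      norm_num at this⟩
  exact ⟨r, hr, hx⟩

lemma norm_exp_mul_I_sub_le (s t : ℝ) :
    ‖Complex.exp (s * Complex.I) - Complex.exp (t * Complex.I)‖ ≤ |s - t| := by
  have h := Real.norm_exp_I_mul_ofReal_sub_one_le (x := s - t)
  have e : Complex.exp (s * Complex.I) - Complex.exp (t * Complex.I) =
      Complex.exp (t * Complex.I) * (Complex.exp (Complex.I * ((s - t : ℝ) : ℂ)) - 1) := by
    rw [mul_sub, ← Complex.exp_add, mul_one]
    congr 2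
    push_cast; ring
  rwa [e, norm_mul, Complex.norm_exp_ofReal_mul_I, one_mul]

lemma norm_polar_sub_le {r s : ℝ} (hs : |s| ≤ 2) (θ φ : ℝ) :
    ‖(r : ℂ) * Complex.exp (θ * Complex.I) - s * Complex.exp (φ * Complex.I)‖ ≤
      |r - s| + 2 * |θ - φ| := by
  have e : (r : ℂ) * Complex.exp (θ * Complex.I) - s * Complex.exp (φ * Complex.I) =
      ((r - s : ℝ) : ℂ) * Complex.exp (θ * Complex.I) +
        s * (Complex.exp (θ * Complex.I) - Complex.exp (φ * Complex.I)) := by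
    push_cast; ring
  rw [e]
  refine (norm_add_le _ _).trans ?_
  rw [norm_mul, norm_mul, Complex.norm_exp_ofReal_mul_I, Complex.norm_real, Complex.norm_real,
    mul_one, Real.norm_eq_abs, Real.norm_eq_abs]
  have := norm_exp_mul_I_sub_le θ φ
  gcongr

lemma abs_radius_sub_le {κ Ω c : ℝ} {h : ℂ → ℝ} {V : ℂ → ℂ}
    (H : IsSmallPotential κ h V) (hκ : κ ≤ 1 / 1000) (hΩ : |Ω - 1 / 4| ≤ 1 / 100)
    {r s θ φ : ℝ} (hr : |r - 1| ≤ 1 / 20) (hs : |s - 1| ≤ 1 / 20)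
    (h₁ : radialStream Ω r + h (r * Complex.exp (θ * Complex.I)) = c)
    (h₂ : radialStream Ω s + h (s * Complex.exp (φ * Complex.I)) = c) :
    |r - s| ≤ 100 * κ * |θ - φ| := by
  have hκ0 : 0 ≤ κ := (norm_nonneg _).trans (H.norm_le 0)
  have hr' := abs_le.1 hr
  have hs' := abs_le.1 hs
  have h1 := abs_sub_div_le_radialStream_sub hΩ (r := r) (s := s) ⟨by linarith, by linarith⟩
    ⟨by linarith, by linarith⟩
  have e : radialStream Ω r - radialStream Ω s = -(h (r * Complex.exp (θ * Complex.I)) -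
    h (s * Complex.exp (φ * Complex.I))) := by linarith
  have hn := norm_polar_sub_le (r := r) (s := s) (by rw [abs_le]; constructor <;> linarith) θ φ
  have hn4 : ‖(r : ℂ) * Complex.exp (θ * Complex.I) - s * Complex.exp (φ * Complex.I)‖ ≤ 4 := by
    refine (norm_sub_le _ _).trans ?_
    rw [norm_mul, norm_mul, Complex.norm_exp_ofReal_mul_I, Complex.norm_exp_ofReal_mul_I,
      Complex.norm_real, Complex.norm_real, Real.norm_of_nonneg (by linarith),
      Real.norm_of_nonneg (by linarith)]
    linarith
  have h2 := H.abs_sub_le hn4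
  rw [e, abs_neg] at h1
  have h3 : 3 * κ * ‖(r : ℂ) * Complex.exp (θ * Complex.I) - s * Complex.exp (φ * Complex.I)‖ ≤
      3 * κ * (|r - s| + 2 * |θ - φ|) := by gcongr
  have h4 : κ * |r - s| ≤ 1 / 1000 * |r - s| := by gcongr
  have h5 : 0 ≤ κ * |θ - φ| := by positivity
  linarith [abs_nonneg (r - s)]

lemma IsSmallPotential.isLittleO {κ : ℝ} {h : ℂ → ℝ} {V : ℂ → ℂ} (H : IsSmallPotential κ h V)
    (x : ℂ) : (fun x' => h x' - h x - ((x' - x) * V x).re) =o[nhds x] fun x' => x' - x := by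
  rw [Asymptotics.isLittleO_iff]
  intro c hc
  have hlim : Filter.Tendsto (fun x' => κ * √‖x' - x‖) (nhds x) (nhds 0) := by
    have : ContinuousAt (fun x' => κ * √‖x' - x‖) x := by fun_prop
    simpa [ContinuousAt] using this
  filter_upwards [hlim.eventually_le_const hc] with x' hx'
  calc ‖h x' - h x - ((x' - x) * V x).re‖ ≤ κ * √‖x' - x‖ ^ 3 := H.taylor x x'
    _ = κ * √‖x' - x‖ * ‖x' - x‖ := by
      rw [pow_succ, Real.sq_sqrt (norm_nonneg _)]; ring
    _ ≤ c * ‖x' - x‖ := by gcongr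

/-- The derivative of the radius along a level set of the relative stream function, as given by
implicit differentiation. -/
noncomputable def polarSlope (Ω : ℝ) (V : ℂ → ℂ) (r θ : ℝ) : ℝ :=
  r * (Complex.exp (θ * Complex.I) * V (r * Complex.exp (θ * Complex.I))).im /
    (radialStreamDeriv Ω r +
      (Complex.exp (θ * Complex.I) * V (r * Complex.exp (θ * Complex.I))).re)

lemma IsSmallPotential.norm_exp_mul_le {κ : ℝ} {h : ℂ → ℝ} {V : ℂ → ℂ}
    (H : IsSmallPotential κ h V) (r θ : ℝ) :
    ‖Complex.exp (θ * Complex.I) * V (r * Complex.exp (θ * Complex.I))‖ ≤ κ := by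
  rw [norm_mul, Complex.norm_exp_ofReal_mul_I, one_mul]
  exact H.norm_le _

lemma IsSmallPotential.le_radialStreamDeriv_add_re {κ Ω r : ℝ} {h : ℂ → ℝ} {V : ℂ → ℂ}
    (H : IsSmallPotential κ h V) (hκ : κ ≤ 1 / 20) (hΩ : |Ω - 1 / 4| ≤ 1 / 100)
    (hr : |r - 1| ≤ 1 / 20) (θ : ℝ) :
    1 / 20 ≤ radialStreamDeriv Ω r +
      (Complex.exp (θ * Complex.I) * V (r * Complex.exp (θ * Complex.I))).re := by
  have hr' := abs_le.1 hr
  have h1 := le_radialStreamDeriv hΩ (r := r) (by linarith) (by linarith)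
  have h2 := (Complex.abs_re_le_norm _).trans (H.norm_exp_mul_le r θ)
  linarith [(abs_le.1 h2).1]

open Asymptotics in
lemma hasDerivAt_radius {κ Ω c : ℝ} {h : ℂ → ℝ} {V : ℂ → ℂ} {R : ℝ → ℝ}
    (H : IsSmallPotential κ h V) (hκ : κ ≤ 1 / 1000) (hΩ : |Ω - 1 / 4| ≤ 1 / 100)
    (hR : ∀ θ, |R θ - 1| ≤ 1 / 20)
    (hc : ∀ θ : ℝ, radialStream Ω (R θ) + h (R θ * Complex.exp (θ * Complex.I)) = c) (θ₀ : ℝ) :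
    HasDerivAt R (polarSlope Ω V (R θ₀) θ₀) θ₀ := by
  have hA := H.le_radialStreamDeriv_add_re (hκ.trans (by norm_num)) hΩ (hR θ₀) θ₀
  set e : ℝ → ℂ := fun θ => Complex.exp (θ * Complex.I) with he
  set z : ℝ → ℂ := fun θ => R θ * e θ with hz
  set A := radialStreamDeriv Ω (R θ₀) + (e θ₀ * V (z θ₀)).re with hAdef
  have hRO : (fun θ => R θ - R θ₀) =O[nhds θ₀] fun θ => θ - θ₀ :=
    IsBigO.of_bound (100 * κ) (Filter.Eventually.of_forall fun θ =>
      abs_radius_sub_le H hκ hΩ (hR θ) (hR θ₀) (hc θ) (hc θ₀))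
  have hRc : Filter.Tendsto R (nhds θ₀) (nhds (R θ₀)) := by
    rw [tendsto_iff_norm_sub_tendsto_zero]
    have : Filter.Tendsto (fun θ => θ - θ₀) (nhds θ₀) (nhds 0) := by
      have : ContinuousAt (fun θ => θ - θ₀) θ₀ := by fun_prop
      simpa [ContinuousAt] using this
    exact (hRO.trans_tendsto this).norm.congr' (by simp) |>.trans (by simp)
  have hzO : (fun θ => z θ - z θ₀) =O[nhds θ₀] fun θ => θ - θ₀ := by
    refine IsBigO.of_bound (100 * κ + 2) (Filter.Eventually.of_forall fun θ => ?_)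
    have h1 := abs_le.1 (hR θ₀)
    refine (norm_polar_sub_le (abs_le.2 ⟨by linarith, by linarith⟩) θ θ₀).trans ?_
    have := abs_radius_sub_le H hκ hΩ (hR θ) (hR θ₀) (hc θ) (hc θ₀)
    rw [Real.norm_eq_abs]
    linarith
  have hzc : Filter.Tendsto z (nhds θ₀) (nhds (z θ₀)) := by
    have : Continuous e := by fun_prop
    exact (Complex.continuous_ofReal.continuousAt.tendsto.comp hRc).mul this.continuousAt.tendsto
  have hed : HasDerivAt e (e θ₀ * Complex.I) θ₀ := by
    have := ((Complex.ofRealCLM.hasDerivAt (x := θ₀)).mul_const Complex.I).cexp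
    simpa [he] using this
  have ha : (fun θ => radialStream Ω (R θ) - radialStream Ω (R θ₀) -
      (R θ - R θ₀) * radialStreamDeriv Ω (R θ₀)) =o[nhds θ₀] fun θ => θ - θ₀ := by
    have h1 := abs_le.1 (hR θ₀)
    have := (hasDerivAt_radialStream Ω (r := R θ₀) (by linarith)).isLittleO
    exact (this.comp_tendsto hRc).trans_isBigO hRO
  have hb : (fun θ => h (z θ) - h (z θ₀) - ((z θ - z θ₀) * V (z θ₀)).re) =o[nhds θ₀]
      fun θ => θ - θ₀ :=
    ((H.isLittleO (z θ₀)).comp_tendsto hzc).trans_isBigO hzO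
  have hcc : (fun θ => ((z θ - z θ₀ - (R θ - R θ₀) * e θ₀ - R θ₀ * (e θ₀ * Complex.I) *
      (θ - θ₀)) * V (z θ₀)).re) =o[nhds θ₀] fun θ => θ - θ₀ := by
    have h1 : (fun θ => ((R θ - R θ₀ : ℝ) : ℂ) * (e θ - e θ₀)) =o[nhds θ₀] fun θ => θ - θ₀ := by
      have h2 : (fun θ => ((R θ - R θ₀ : ℝ) : ℂ)) =O[nhds θ₀] fun θ => θ - θ₀ :=
        IsBigO.of_norm_left (hRO.norm_left.congr_left fun θ => by rw [Complex.norm_real])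
      have h3 : (fun θ => e θ - e θ₀) =o[nhds θ₀] fun _ => (1 : ℝ) := by
        rw [isLittleO_one_iff]
        have := hed.continuousAt.tendsto.sub_const (e θ₀)
        simpa using this
      simpa using h2.mul_isLittleO h3
    have h4 : (fun θ => (R θ₀ : ℂ) * (e θ - e θ₀ - (θ - θ₀) • (e θ₀ * Complex.I)))
        =o[nhds θ₀] fun θ => θ - θ₀ := hed.isLittleO.const_mul_left _
    have h5 : (fun θ => (z θ - z θ₀ - (R θ - R θ₀) * e θ₀ - R θ₀ * (e θ₀ * Complex.I) *
      (θ - θ₀)) * V (z θ₀)) =o[nhds θ₀] fun θ => θ - θ₀ := by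
      have := (h1.add h4).const_mul_left (V (z θ₀))
      refine this.congr_left fun θ => ?_
      simp only [hz, Complex.real_smul]
      push_cast
      ring
    refine IsLittleO.of_norm_left ?_
    exact (IsBigO.of_norm_le fun θ => by
      rw [norm_norm]; exact Complex.abs_re_le_norm _).trans_isLittleO h5.norm_left
  rw [hasDerivAt_iff_isLittleO]
  have key := (((ha.add hb).add hcc).const_mul_left (-A⁻¹))
  refine key.congr_left fun θ => ?_
  have e1 := hc θ
  have e2 := hc θ₀
  have e3 : polarSlope Ω V (R θ₀) θ₀ = R θ₀ * (e θ₀ * V (z θ₀)).im / A := rfl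
  have hA0 : A ≠ 0 := by linarith
  change radialStream Ω (R θ) + h (z θ) = c at e1
  change radialStream Ω (R θ₀) + h (z θ₀) = c at e2
  have e4 : ((z θ - z θ₀ - (R θ - R θ₀) * e θ₀ - R θ₀ * (e θ₀ * Complex.I) *
      (θ - θ₀)) * V (z θ₀)).re = ((z θ - z θ₀) * V (z θ₀)).re -
      (R θ - R θ₀) * (e θ₀ * V (z θ₀)).re + R θ₀ * (θ - θ₀) * (e θ₀ * V (z θ₀)).im := by
    have : (z θ - z θ₀ - (R θ - R θ₀) * e θ₀ - R θ₀ * (e θ₀ * Complex.I) *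
      (θ - θ₀)) * V (z θ₀) = (z θ - z θ₀) * V (z θ₀) -
      ((R θ - R θ₀ : ℝ) : ℂ) * (e θ₀ * V (z θ₀)) -
      ((R θ₀ * (θ - θ₀) : ℝ) : ℂ) * ((e θ₀ * V (z θ₀)) * Complex.I) := by
      push_cast; ring
    rw [this, Complex.sub_re, Complex.sub_re, Complex.re_ofReal_mul, Complex.re_ofReal_mul,
      Complex.mul_I_re]
    ring
  rw [e4, e3, smul_eq_mul]
  generalize (e θ₀ * V (z θ₀)).re = p at hAdef ⊢
  field_simp
  rw [hAdef]
  linear_combination e2 - e1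

lemma abs_polarSlope_le {κ Ω r : ℝ} {h : ℂ → ℝ} {V : ℂ → ℂ}
    (H : IsSmallPotential κ h V) (hκ : κ ≤ 1 / 20) (hΩ : |Ω - 1 / 4| ≤ 1 / 100)
    (hr : |r - 1| ≤ 1 / 20) (θ : ℝ) : |polarSlope Ω V r θ| ≤ 24 * κ := by
  have hκ0 : 0 ≤ κ := (norm_nonneg _).trans (H.norm_le 0)
  have hA := H.le_radialStreamDeriv_add_re hκ hΩ hr θ
  have him := (Complex.abs_im_le_norm _).trans (H.norm_exp_mul_le r θ)
  have hr' := abs_le.1 hr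
  have hr0 : |r| ≤ 21 / 20 := abs_le.2 ⟨by linarith, by linarith⟩
  rw [polarSlope, abs_div, abs_of_pos (a := _ + _) (by linarith), div_le_iff₀ (by linarith),
    abs_mul]
  calc _ ≤ 21 / 20 * κ := by gcongr
    _ ≤ 24 * κ * (1 / 20) := by linarith
    _ ≤ _ := by gcongr

lemma abs_polarSlope_sub_le {κ Ω r s θ φ : ℝ} {h : ℂ → ℝ} {V : ℂ → ℂ}
    (H : IsSmallPotential κ h V) (hκ : κ ≤ 1 / 1000) (hΩ : |Ω - 1 / 4| ≤ 1 / 100)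
    (hr : |r - 1| ≤ 1 / 20) (hs : |s - 1| ≤ 1 / 20) (hrs : |r - s| ≤ 100 * κ * |θ - φ|) :
    |polarSlope Ω V r θ - polarSlope Ω V s φ| ≤ 2000 * κ * √|θ - φ| := by
  have hκ0 : 0 ≤ κ := (norm_nonneg _).trans (H.norm_le 0)
  have b₁ := abs_polarSlope_le H (hκ.trans (by norm_num)) hΩ hr θ
  have b₂ := abs_polarSlope_le H (hκ.trans (by norm_num)) hΩ hs φ
  have hA₁ := H.le_radialStreamDeriv_add_re (hκ.trans (by norm_num)) hΩ hr θ
  have hA₂ := H.le_radialStreamDeriv_add_re (hκ.trans (by norm_num)) hΩ hs φ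
  have hr' := abs_le.1 hr
  have hs' := abs_le.1 hs
  have hs0 : |s| ≤ 21 / 20 := abs_le.2 ⟨by linarith, by linarith⟩
  set d := √|θ - φ| with hd
  have hd0 : 0 ≤ d := Real.sqrt_nonneg _
  have hdsq : |θ - φ| = d ^ 2 := (Real.sq_sqrt (abs_nonneg _)).symm
  rcases le_total 1 d with h1 | h1
  · have := abs_sub (polarSlope Ω V r θ) (polarSlope Ω V s φ)
    have h2 : κ * 1 ≤ κ * d := by gcongr
    linarith
  have hd2 : d ^ 2 ≤ d := by nlinarith
  have hz : ‖(r : ℂ) * Complex.exp (θ * Complex.I) - s * Complex.exp (φ * Complex.I)‖ ≤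
      (2 * d) ^ 2 := by
    have := norm_polar_sub_le (r := r) (s := s) (abs_le.2 ⟨by linarith, by linarith⟩) θ φ
    have h3 : 100 * κ * d ^ 2 ≤ 1 * d ^ 2 := by gcongr; linarith
    rw [hdsq] at this hrs
    nlinarith [sq_nonneg d]
  have hzs := Real.sqrt_le_iff.2 ⟨by positivity, hz⟩
  have hW : ‖Complex.exp (θ * Complex.I) * V (r * Complex.exp (θ * Complex.I)) -
      Complex.exp (φ * Complex.I) * V (s * Complex.exp (φ * Complex.I))‖ ≤ 3 * κ * d := by
    set v := V (r * Complex.exp (θ * Complex.I)) with hv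
    set w := V (s * Complex.exp (φ * Complex.I)) with hw
    have e : Complex.exp (θ * Complex.I) * v - Complex.exp (φ * Complex.I) * w =
      (Complex.exp (θ * Complex.I) - Complex.exp (φ * Complex.I)) * v +
        Complex.exp (φ * Complex.I) * (v - w) := by ring
    have h4 := norm_exp_mul_I_sub_le θ φ
    have h5 : ‖v - w‖ ≤ κ * (2 * d) := (H.holder _ _).trans (by gcongr)
    have h6 : ‖v‖ ≤ κ := H.norm_le _
    rw [e]
    refine (norm_add_le _ _).trans ?_
    rw [norm_mul, norm_mul, Complex.norm_exp_ofReal_mul_I]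
    have h7 : ‖Complex.exp (θ * Complex.I) - Complex.exp (φ * Complex.I)‖ * ‖v‖ ≤ d * κ := by
      gcongr
      linarith
    linarith
  have hre := (Complex.abs_re_le_norm _).trans hW
  have him := (Complex.abs_im_le_norm _).trans hW
  have him₁ := (Complex.abs_im_le_norm _).trans (H.norm_exp_mul_le r θ)
  rw [Complex.sub_re] at hre
  rw [Complex.sub_im] at him
  have hG := abs_radialStreamDeriv_sub_le hΩ (r := r) (s := s) (by linarith) (by linarith)
  unfold polarSlope at b₁ b₂ ⊢
  set W₁ := Complex.exp (θ * Complex.I) * V (r * Complex.exp (θ * Complex.I))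
  set W₂ := Complex.exp (φ * Complex.I) * V (s * Complex.exp (φ * Complex.I))
  set A₁ := radialStreamDeriv Ω r + W₁.re with hA₁'
  set A₂ := radialStreamDeriv Ω s + W₂.re with hA₂'
  have hrs' : |r - s| ≤ 100 * κ * d := hrs.trans (by rw [hdsq]; gcongr)
  have hA : |A₁ - A₂| ≤ 3 * d := by
    have e : A₁ - A₂ = (radialStreamDeriv Ω r - radialStreamDeriv Ω s) + (W₁.re - W₂.re) := by
      rw [hA₁', hA₂']; ring
    have h3 : κ * d ≤ 1 / 1000 * d := by gcongr
    rw [e]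
    have := abs_add_le (radialStreamDeriv Ω r - radialStreamDeriv Ω s) (W₁.re - W₂.re)
    linarith
  have hN : |r * W₁.im - s * W₂.im| ≤ 5 * κ * d := by
    have e : r * W₁.im - s * W₂.im = (r - s) * W₁.im + s * (W₁.im - W₂.im) := by ring
    rw [e]
    refine (abs_add_le _ _).trans ?_
    rw [abs_mul, abs_mul]
    have h3 : |r - s| * |W₁.im| ≤ 100 * κ * d * (1 / 1000) := by
      gcongr
      exact him₁.trans hκ
    have h4 : |s| * |W₁.im - W₂.im| ≤ 21 / 20 * (3 * κ * d) := by gcongr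
    have h5 : 0 ≤ κ * d := by positivity
    linarith
  have hA₁0 : A₁ ≠ 0 := by linarith
  have hA₂0 : A₂ ≠ 0 := by linarith
  have e : r * W₁.im / A₁ - s * W₂.im / A₂ =
      ((r * W₁.im - s * W₂.im) - s * W₂.im / A₂ * (A₁ - A₂)) / A₁ := by
    field_simp
    ring
  rw [e, abs_div, abs_of_pos (a := A₁) (by linarith), div_le_iff₀ (by linarith)]
  refine (abs_sub _ _).trans ?_
  rw [abs_mul]
  calc _ ≤ 5 * κ * d + 24 * κ * (3 * d) := by gcongr
    _ ≤ 2000 * κ * d * (1 / 20) := by nlinarith [mul_nonneg hκ0 hd0]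
    _ ≤ _ := by gcongr

lemma exists_mem_ball_notMem {S : Set ℂ} {ρ : ℝ}
    (h : volume S < volume (Metric.ball (0 : ℂ) ρ)) (a : ℂ) : ∃ x, ‖x - a‖ < ρ ∧ x ∉ S := by
  by_contra! hcon
  have h1 : Metric.ball a ρ ⊆ S := fun x hx => hcon x (mem_ball_iff_norm.1 hx)
  have h2 := measure_mono (μ := volume) h1
  rw [Measure.addHaar_ball_center] at h2
  exact absurd h2 (not_le.2 h)

lemma exists_radius_of_frontier_near_circle {κ η Ω c : ℝ} {h : ℂ → ℝ} {V : ℂ → ℂ} {D : Set ℂ}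
    (H : IsSmallPotential κ h V) (hκ : κ ≤ 1 / 1000) (hη : η ≤ 1 / 20)
    (hΩ : |Ω - 1 / 4| ≤ 1 / 100) (hc : ∀ x ∈ frontier D, radialStream Ω ‖x‖ + h x = c)
    (hD : ∀ x ∈ frontier D, |‖x‖ - 1| ≤ η)
    (hray : ∀ θ : ℝ, ∃ r : ℝ, 0 ≤ r ∧ (r : ℂ) * Complex.exp (θ * Complex.I) ∈ frontier D) :
    ∃ R R' : ℝ → ℝ, Function.Periodic R (2 * Real.pi) ∧ (∀ θ, HasDerivAt R (R' θ) θ) ∧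
      frontier D = {z : ℂ | ∃ θ : ℝ, z = (R θ : ℂ) * Complex.exp ((θ : ℂ) * Complex.I)} ∧
      (∀ θ, |R θ - 1| ≤ η) ∧ (∀ θ, |R' θ| ≤ 24 * κ) ∧
      (∀ θ φ, |R' θ - R' φ| ≤ 2000 * κ * √|θ - φ|) := by
  choose R hR0 hRf using hray
  have hnorm : ∀ (r θ : ℝ), 0 ≤ r → ‖(r : ℂ) * Complex.exp (θ * Complex.I)‖ = r := fun r θ hr => by
    rw [norm_mul, Complex.norm_exp_ofReal_mul_I, mul_one, Complex.norm_of_nonneg hr]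
  have hR : ∀ θ, |R θ - 1| ≤ η := fun θ => by
    have := hD _ (hRf θ)
    rwa [hnorm _ _ (hR0 θ)] at this
  have hlevel : ∀ θ : ℝ, radialStream Ω (R θ) + h (R θ * Complex.exp (θ * Complex.I)) = c :=
    fun θ => by
      have := hc _ (hRf θ)
      rwa [hnorm _ _ (hR0 θ)] at this
  have huniq : ∀ (θ r : ℝ), 0 ≤ r → (r : ℂ) * Complex.exp (θ * Complex.I) ∈ frontier D →
      r = R θ := fun θ r hr hmem => by
    have h1 := hD _ hmem
    have h2 := hc _ hmem
    rw [hnorm _ _ hr] at h1 h2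
    have := abs_radius_sub_le H hκ hΩ (h1.trans hη) ((hR θ).trans hη) h2 (hlevel θ)
    rw [sub_self, abs_zero, mul_zero] at this
    linarith [abs_nonpos_iff.1 this]
  have hR20 : ∀ θ, |R θ - 1| ≤ 1 / 20 := fun θ => (hR θ).trans hη
  refine ⟨R, fun θ => polarSlope Ω V (R θ) θ, fun θ => huniq θ _ (hR0 _) ?_,
    hasDerivAt_radius H hκ hΩ hR20 hlevel, ?_, hR,
    fun θ => abs_polarSlope_le H (hκ.trans (by norm_num)) hΩ (hR20 θ) θ,
    fun θ φ => abs_polarSlope_sub_le H hκ hΩ (hR20 θ) (hR20 φ)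
      (abs_radius_sub_le H hκ hΩ (hR20 θ) (hR20 φ) (hlevel θ) (hlevel φ))⟩
  · have := hRf (θ + 2 * Real.pi)
    have e : Complex.exp (((θ + 2 * Real.pi : ℝ) : ℂ) * Complex.I) =
        Complex.exp (θ * Complex.I) := by
      push_cast
      rw [add_mul]
      exact Complex.exp_periodic _
    rwa [e] at this
  · ext z
    constructor
    · intro hz
      refine ⟨z.arg, ?_⟩
      rw [← huniq z.arg ‖z‖ (norm_nonneg z) (by rwa [Complex.norm_mul_exp_arg_mul_I])]
      exact (Complex.norm_mul_exp_arg_mul_I z).symm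
    · rintro ⟨θ, rfl⟩
      exact hRf θ

theorem boundary_of_weakly_close_vstate_is_C1half_polar_graph :
    ∀ ε : ℝ, 0 < ε →
    ∃ δ₀ : ℝ, 0 < δ₀ ∧ ∀ δ : ℝ, 0 < δ → δ ≤ δ₀ →
      ∀ (D : Set ℂ) (Ω : ℝ),
        Bornology.IsBounded D → IsOpen D → SimplyConnectedSpace D →
        IsVState D Ω →
        |Ω - 1 / 4| ≤ δ →
        (volume (symmDiff (Metric.ball (0 : ℂ) 1) D)).toReal ≤ δ →
        ∃ R R' : ℝ → ℝ,
          (∀ θ, 0 < R θ) ∧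
          Function.Periodic R (2 * Real.pi) ∧
          (∀ θ, HasDerivAt R (R' θ) θ) ∧
          Continuous R' ∧
          frontier D =
            {z : ℂ | ∃ θ : ℝ, z = (R θ : ℂ) * Complex.exp ((θ : ℂ) * Complex.I)} ∧
          (∀ θ, |R θ - 1| ≤ ε) ∧
          (∀ θ, |R' θ| ≤ ε) ∧
          (∀ θ₁ θ₂, |R' θ₁ - R' θ₂| ≤ ε * |θ₁ - θ₂| ^ (1 / 2 : ℝ)) := by
  intro ε hε
  obtain ⟨η, hη0, hηε, hη⟩ : ∃ η : ℝ, 0 < η ∧ η ≤ ε / 4 ∧ η ≤ 1 / 40 :=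
    ⟨min (ε / 4) (1 / 40), by positivity, min_le_left _ _, min_le_right _ _⟩
  obtain ⟨δ₁, hδ₁, hpot⟩ := exists_relStream_eq_add_smallPotential (κ := η / 1000) (by positivity)
  have hball : volume (Metric.ball (0 : ℂ) (η / 2)) ≠ ⊤ := measure_ball_lt_top.ne
  have hball0 : 0 < (volume (Metric.ball (0 : ℂ) (η / 2))).toReal :=
    ENNReal.toReal_pos (Metric.measure_ball_pos _ _ (by positivity)).ne' hball
  refine ⟨min (1 / 100) (min (δ₁ / 2) ((volume (Metric.ball (0 : ℂ) (η / 2))).toReal / 2)),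
    by positivity, fun δ hδ hδ₀ D Ω hDb hDo hDs ⟨c, hc⟩ hΩ hvol => ?_⟩
  rw [le_min_iff, le_min_iff] at hδ₀
  have hfin : volume (symmDiff (Metric.ball (0 : ℂ) 1) D) ≠ ⊤ :=
    ((Metric.isBounded_ball.union hDb).subset symmDiff_subset_union).measure_lt_top.ne
  have hsmall : volume (symmDiff (Metric.ball (0 : ℂ) 1) D) <
      volume (Metric.ball (0 : ℂ) (η / 2)) :=
    (ENNReal.toReal_lt_toReal hfin hball).1 (by linarith)
  obtain ⟨h, V, H, hstream⟩ := hpot D hDo hDb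
    ((ENNReal.lt_ofReal_iff_toReal_lt hfin).2 (by linarith))
  have hΩ' : |Ω - 1 / 4| ≤ 1 / 100 := hΩ.trans hδ₀.1
  have hc' : ∀ x ∈ frontier D, radialStream Ω ‖x‖ + h x = c := fun x hx => by
    rw [← hc x hx, hstream Ω x, radialStream]
  have hDc : IsPreconnected D := isPreconnected_iff_preconnectedSpace.2 inferInstance
  have hpoint (t : ℝ) (ht : 0 ≤ t) : ∃ x : ℂ, t - η / 2 < ‖x‖ ∧ ‖x‖ < t + η / 2 ∧
      (x ∈ Metric.ball (0 : ℂ) 1 ↔ x ∈ D) := by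
    obtain ⟨x, hx, hxS⟩ := exists_mem_ball_notMem hsmall t
    have h1 := (abs_norm_sub_norm_le x t).trans_lt hx
    rw [Complex.norm_of_nonneg ht, abs_lt] at h1
    rw [mem_symmDiff] at hxS
    exact ⟨x, by linarith, by linarith, by tauto⟩
  simp only [mem_ball_zero_iff] at hpoint
  obtain ⟨p, hp₁, hp₂, hp⟩ := hpoint (1 - η / 2) (by linarith)
  obtain ⟨p', hp₁', hp₂', hp'⟩ := hpoint (1 + η / 2) (by linarith)
  obtain ⟨q, -, hq₂, hq⟩ := hpoint 0 le_rfl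
  obtain ⟨q', hq₁', hq₂', hq'⟩ := hpoint (23 / 20) (by norm_num)
  obtain ⟨hfront, h0, hD⟩ := frontier_near_circle H hη le_rfl hη0 hΩ' hDc hc'
    ⟨p, hp.1 (by linarith), by linarith, by linarith⟩
    ⟨p', fun hmem => by linarith [hp'.2 hmem], by linarith, by linarith⟩
    ⟨q, hq.1 (by linarith), by linarith⟩
    ⟨q', fun hmem => by linarith [hq'.2 hmem], by linarith, by linarith⟩
  obtain ⟨R, R', hper, hder, hgraph, hR, hR', hHol⟩ := exists_radius_of_frontier_near_circle H
    (by linarith) (η := 2 * η) (by linarith) hΩ' hc' hfront (exists_mem_frontier_ray h0 hD)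
  refine ⟨R, R', fun θ => by linarith [(abs_le.1 (hR θ)).1], hper, hder, ?_, hgraph,
    fun θ => (hR θ).trans (by linarith), fun θ => (hR' θ).trans (by linarith), fun θ φ => ?_⟩
  · refine continuous_iff_continuousAt.2 fun φ => tendsto_iff_norm_sub_tendsto_zero.2 ?_
    have hlim : ContinuousAt (fun θ => 2000 * (η / 1000) * √|θ - φ|) φ := by fun_prop
    refine squeeze_zero (fun _ => norm_nonneg _) (fun θ => hHol θ φ) ?_
    simpa [ContinuousAt] using hlim
  · rw [← Real.sqrt_eq_rpow]
    refine (hHol θ φ).trans ?_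
    gcongr
    linarith
end

section
/- There exists δ₀ > 0 such that for every 0 < δ ≤ δ₀ the following holds. Let D ⊂ ℝ² be a bounded open simply connected set and Ω ∈ ℝ, and assume the relative stream function Ψ(x) = (1/(2π)) ∫_D log|x − y| dy − Ω|x|²/2 takes a constant value on ∂D (i.e. D is a V-state with angular velocity Ω and rotation center the origin). If |Ω − 1/4| ≤ δ and |𝔻 Δ D| ≤ δ, then D is contained in the ball of radius 10000 centered at the origin. -/
open MeasureTheory Set

theorem integrable_indicator_inv_norm :
    Integrable (fun z : ℂ => (Ioo (0 : ℝ) 1).indicator (fun r => r⁻¹) ‖z‖) := by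
  rw [integrable_fun_norm_addHaar volume (f := (Ioo (0 : ℝ) 1).indicator (fun r => r⁻¹))]
  have h : IntegrableOn ((Ioo (0 : ℝ) 1).indicator (fun _ => (1 : ℝ))) (Ioi 0) :=
    ((integrable_indicator_iff measurableSet_Ioo).2
      (integrableOn_const (by simp))).integrableOn
  refine h.congr_fun (fun r hr => ?_) measurableSet_Ioi
  have hr : (0 : ℝ) < r := hr
  by_cases h1 : r < 1 <;> simp [indicator, hr, h1, hr.ne']

theorem integral_indicator_inv_norm :
    ∫ z : ℂ, (Ioo (0 : ℝ) 1).indicator (fun r => r⁻¹) ‖z‖ = 2 * Real.pi := by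
  rw [integral_fun_norm_addHaar volume ((Ioo (0 : ℝ) 1).indicator (fun r => r⁻¹))]
  have h : ∫ r in Ioi (0 : ℝ), r ^ (Module.finrank ℝ ℂ - 1) •
      (Ioo (0 : ℝ) 1).indicator (fun r => r⁻¹) r = 1 := by
    have : ∫ r in Ioi (0 : ℝ), (Ioo (0 : ℝ) 1).indicator (fun _ => (1 : ℝ)) r = 1 := by
      rw [setIntegral_indicator measurableSet_Ioo, inter_eq_right.2 Ioo_subset_Ioi_self]
      simp
    refine (setIntegral_congr_fun measurableSet_Ioi fun r hr => ?_).trans this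
    have hr : (0 : ℝ) < r := hr
    by_cases h1 : r < 1 <;> simp [indicator, hr, h1, hr.ne']
  rw [h]
  simp [measureReal_def]

/-- The logarithmic potential of a planar set is bounded below by a universal constant. -/
theorem neg_two_pi_le_setIntegral_log_norm_sub (D : Set ℂ) (x : ℂ) :
    -(2 * Real.pi) ≤ ∫ y in D, Real.log ‖x - y‖ := by
  by_cases hint : IntegrableOn (fun y => Real.log ‖x - y‖) D
  · set g : ℂ → ℝ := fun z => (Ioo (0 : ℝ) 1).indicator (fun r => r⁻¹) ‖z‖ with hg
    have hgi : Integrable (fun y => g (x - y)) := integrable_indicator_inv_norm.comp_sub_left x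
    have hg0 : ∀ z, 0 ≤ g z := fun z => indicator_nonneg (fun r hr => inv_nonneg.2 hr.1.le) _
    have hle : ∫ y in D, g (x - y) ≤ 2 * Real.pi := by
      rw [← integral_indicator_inv_norm, ← integral_sub_left_eq_self g volume x]
      exact setIntegral_le_integral hgi (Filter.Eventually.of_forall fun y => hg0 _)
    have hmono : ∫ y in D, -g (x - y) ≤ ∫ y in D, Real.log ‖x - y‖ := by
      refine setIntegral_mono hgi.neg.integrableOn hint fun y => ?_
      simp only [hg]
      rcases (norm_nonneg (x - y)).eq_or_lt with h0 | h0
      · simp [← h0]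
      · by_cases h1 : ‖x - y‖ < 1
        · rw [indicator_of_mem (show ‖x - y‖ ∈ Ioo (0 : ℝ) 1 from ⟨h0, h1⟩)]
          have := Real.log_le_sub_one_of_pos (inv_pos.2 h0)
          rw [Real.log_inv] at this
          linarith
        · rw [indicator_of_notMem (fun h => h1 h.2), neg_zero]
          exact Real.log_nonneg (not_lt.1 h1)
    rw [integral_neg] at hmono
    linarith
  · rw [integral_undef hint]
    linarith [Real.pi_pos]

/-- Upper bound for the logarithmic potential of a set in a disk. -/
theorem setIntegral_log_norm_sub_le {D : Set ℂ} (hD : MeasurableSet D) {R : ℝ} (hR : 1 ≤ R)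
    (hDR : ∀ y ∈ D, ‖y‖ ≤ R) {x : ℂ} (hx : ‖x‖ ≤ R) :
    ∫ y in D, Real.log ‖x - y‖ ≤ volume.real D * (2 * R) := by
  have hfin : volume D ≠ ⊤ := ne_top_of_le_ne_top
    (isCompact_closedBall (0 : ℂ) R).measure_lt_top.ne
    (measure_mono fun y hy => by simpa using hDR y hy)
  by_cases hint : IntegrableOn (fun y => Real.log ‖x - y‖) D
  · refine (setIntegral_mono_on hint (integrableOn_const (C := 2 * R) hfin) hD
      fun y hy => ?_).trans_eq (by simp)
    have h2 : ‖x - y‖ ≤ 2 * R := (norm_sub_le x y).trans (by linarith [hDR y hy])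
    exact (Real.log_le_self (norm_nonneg _)).trans h2
  · rw [integral_undef hint]
    positivity

/-- A nonempty bounded set in the plane has a boundary point of maximal norm. -/
theorem exists_mem_frontier_forall_norm_le {D : Set ℂ} (hb : Bornology.IsBounded D) (hne : D.Nonempty) :
    ∃ x ∈ frontier D, ∀ y ∈ D, ‖y‖ ≤ ‖x‖ := by
  obtain ⟨x, hx, hmax⟩ := Complex.exists_mem_frontier_isMaxOn_norm hb hne
    (differentiable_id (𝕜 := ℂ)).diffContOnCl
  exact ⟨x, hx, fun y hy => hmax (subset_closure hy)⟩

theorem inter_frontier_nonempty_of_isPreconnected_s6 {X : Type*} [TopologicalSpace X] {s t : Set X}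
    (hs : IsPreconnected s) (h : (s ∩ t).Nonempty) (h' : (s ∩ tᶜ).Nonempty) :
    (s ∩ frontier t).Nonempty := by
  by_contra hne
  have hcov : s ⊆ interior t ∪ interior tᶜ := by
    rw [← compl_frontier_eq_union_interior]
    exact fun x hx hxf => hne ⟨x, hx, hxf⟩
  obtain ⟨a, has, hat⟩ := h
  obtain ⟨b, hbs, hbt⟩ := h'
  have ha : a ∈ interior t := (hcov has).resolve_right fun h => interior_subset h hat
  have hb : b ∈ interior tᶜ := (hcov hbs).resolve_left fun h => hbt (interior_subset h)
  obtain ⟨x, -, hx, hx'⟩ := hs _ _ isOpen_interior isOpen_interior hcov ⟨a, has, ha⟩ ⟨b, hbs, hb⟩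
  exact interior_subset hx' (interior_subset hx)

theorem weakly_close_vstate_is_uniformly_bounded :
    ∃ δ₀ : ℝ, 0 < δ₀ ∧ ∀ δ : ℝ, 0 < δ → δ ≤ δ₀ →
      ∀ (D : Set ℂ) (Ω : ℝ),
        Bornology.IsBounded D → IsOpen D → SimplyConnectedSpace D →
        IsVState D Ω →
        |Ω - 1 / 4| ≤ δ →
        (volume (symmDiff (Metric.ball (0 : ℂ) 1) D)).toReal ≤ δ →
        D ⊆ Metric.ball (0 : ℂ) 10000 := by
  refine ⟨1 / 8, by norm_num, fun δ hδ hδ' D Ω hb ho _ ⟨c, hc⟩ hΩ hvol z hz => ?_⟩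
  by_contra hzfar
  have hzfar : (10000 : ℝ) ≤ ‖z‖ := by simpa using hzfar
  have hΩ' : 1 / 8 ≤ Ω := by linarith [(abs_le.1 (hΩ.trans hδ')).1]
  have hball : ∀ r : ℝ, 0 ≤ r → volume.real (Metric.ball (0 : ℂ) r) = r ^ 2 * Real.pi := by
    intro r hr
    simp [measureReal_def, hr]
  have hsymm : volume.real (symmDiff (Metric.ball (0 : ℂ) 1) D) ≤ 1 / 8 := hvol.trans hδ'
  have hDfin : volume D ≠ ⊤ := hb.measure_lt_top.ne
  have hsfin : volume (symmDiff (Metric.ball (0 : ℂ) 1) D) ≠ ⊤ :=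
    ((Metric.isBounded_ball.union hb).subset symmDiff_subset_union).measure_lt_top.ne
  have hDvol : volume.real D ≤ 4 := by
    have h : D ⊆ Metric.ball (0 : ℂ) 1 ∪ symmDiff (Metric.ball (0 : ℂ) 1) D := by
      intro y hy
      by_cases hy1 : y ∈ Metric.ball (0 : ℂ) 1
      · exact Or.inl hy1
      · exact Or.inr (Or.inr ⟨hy, hy1⟩)
    have h1 := (measureReal_mono (μ := volume) h
      (measure_union_lt_top Metric.isBounded_ball.measure_lt_top hsfin.lt_top).ne).trans
      (measureReal_union_le _ _)
    rw [hball 1 zero_le_one] at h1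
    linarith [Real.pi_lt_d2]
  have hnear : ∃ x ∈ frontier D, ‖x‖ ≤ 2 := by
    have hmeet : (Metric.ball (0 : ℂ) 2 ∩ D).Nonempty := by
      by_contra hne
      have h : Metric.ball (0 : ℂ) 1 ⊆ symmDiff (Metric.ball (0 : ℂ) 1) D := fun y hy =>
        Or.inl ⟨hy, fun hyD => hne ⟨y, Metric.ball_subset_ball one_le_two hy, hyD⟩⟩
      have h1 := measureReal_mono (μ := volume) h hsfin
      rw [hball 1 zero_le_one] at h1
      linarith [Real.pi_gt_three]
    have hmeet' : (Metric.ball (0 : ℂ) 2 ∩ Dᶜ).Nonempty := by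
      by_contra hne
      have h : Metric.ball (0 : ℂ) 2 ⊆ D := fun y hy => by
        by_contra hyD
        exact hne ⟨y, hy, hyD⟩
      have h1 := measureReal_mono (μ := volume) h hDfin
      rw [hball 2 zero_le_two] at h1
      linarith [Real.pi_gt_three]
    obtain ⟨x, hx, hxf⟩ := inter_frontier_nonempty_of_isPreconnected_s6
      Metric.isPreconnected_ball hmeet hmeet'
    exact ⟨x, hxf, le_of_lt (by simpa using hx)⟩
  obtain ⟨p, hp, hp2⟩ := hnear
  obtain ⟨x, hx, hmax⟩ := exists_mem_frontier_forall_norm_le hb ⟨z, hz⟩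
  have hR : (10000 : ℝ) ≤ ‖x‖ := hzfar.trans (hmax z hz)
  have hlow := neg_two_pi_le_setIntegral_log_norm_sub D p
  have hup := setIntegral_log_norm_sub_le ho.measurableSet (by linarith) hmax le_rfl
  have heq : relStream D Ω x = relStream D Ω p := (hc x hx).trans (hc p hp).symm
  unfold relStream at heq
  have hpi := Real.pi_gt_three
  have hlow' : -1 ≤ 1 / (2 * Real.pi) * ∫ y in D, Real.log ‖p - y‖ := by
    rw [one_div_mul_eq_div, le_div_iff₀ (by positivity)]
    linarith
  have hup' : 1 / (2 * Real.pi) * (∫ y in D, Real.log ‖x - y‖) ≤ 2 * ‖x‖ := by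
    rw [one_div_mul_eq_div, div_le_iff₀ (by positivity)]
    nlinarith
  have hsq : Ω * (‖x‖ ^ 2 - ‖p‖ ^ 2) ≥ 1 / 8 * (‖x‖ ^ 2 - 4) := by
    have : ‖p‖ ^ 2 ≤ 4 := by nlinarith [norm_nonneg p]
    have hpos : 0 ≤ ‖x‖ ^ 2 - ‖p‖ ^ 2 := by nlinarith
    linarith [mul_le_mul_of_nonneg_right hΩ' hpos]
  nlinarith
end
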